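/- arXiv:2106.06374 — 5 statements merged into one kernel-verified Lean document; each statement's English description precedes it below -/
import Mathlib

section
/- Let f : 𝔸 → 𝔸 be a homeomorphism of the annulus such that both boundary circles A₀ and A₁ are contained in the chain recurrent set ℛ(f), but A₀ and A₁ are not contained in the same chain transitive component of ℛ(f). Then there exists an essential simple closed curve γ ⊂ 𝔸 with f(γ) ∩ γ = ∅; in particular, f does not satisfy the intersection property. -/
open Set Metric

noncomputable section

/-- The circle `S¹ = ℝ/ℤ`. -/
abbrev S1 : Type := AddCircle (1 : ℝ)

/-- The unit interval `[0,1]` as a type. -/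
abbrev I01 : Type := Set.Icc (0 : ℝ) 1

/-- The annulus `𝔸 = S¹ × [0,1]`. -/
abbrev Ann : Type := S1 × I01

def iZero : I01 := ⟨0, by norm_num⟩
def iOne : I01 := ⟨1, by norm_num⟩

/-- The boundary circle `A₀ = S¹ × {0}`. -/
def A0 : Set Ann := {p | p.2 = iZero}

/-- The boundary circle `A₁ = S¹ × {1}`. -/
def A1 : Set Ann := {p | p.2 = iOne}

/-- The covering map `ℝ × [0,1] → 𝔸`. -/
def annCover : ℝ × I01 → Ann := fun p => ((p.1 : S1), p.2)

/-- `F` is a lift of `f` through the covering map, commuting with the deck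
transformation `(x,y) ↦ (x+1,y)`. -/
def IsLift (f : Ann → Ann) (F : ℝ × I01 → ℝ × I01) : Prop :=
  (∀ p, annCover (F p) = f (annCover p)) ∧
  ∀ p : ℝ × I01, F (p.1 + 1, p.2) = ((F p).1 + 1, (F p).2)

/-- An essential simple closed curve in `Y`: a continuous injective map from the
circle which is not null-homotopic (not contractible). -/
def IsEssentialCurve {Y : Type*} [TopologicalSpace Y] (γ : C(S1, Y)) : Prop :=
  Function.Injective γ ∧ ¬ γ.Nullhomotopic

/-- `f` satisfies the intersection property if every essential simple closed curve
meets its image under `f`. -/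
def IntersectionProperty {Y : Type*} [TopologicalSpace Y] (f : Y → Y) : Prop :=
  ∀ γ : C(S1, Y), IsEssentialCurve γ → (f '' Set.range γ ∩ Set.range γ).Nonempty

/-- The twist condition: some lift `F` of `f` moves the two boundary lines in
opposite directions: `F(x,1) = (x + r₁ x, 1)`, `F(x,0) = (x - r₀ x, 0)` with
`r₀ x, r₁ x > 0`. -/
def TwistCondition (f : Ann → Ann) : Prop :=
  ∃ F : (ℝ × I01) ≃ₜ (ℝ × I01), IsLift f ⇑F ∧
    ∃ r₀ r₁ : ℝ → ℝ,
      (∀ x, 0 < r₀ x) ∧ (∀ x, 0 < r₁ x) ∧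
      (∀ x : ℝ, F (x, iOne) = (x + r₁ x, iOne)) ∧
      (∀ x : ℝ, F (x, iZero) = (x - r₀ x, iZero))

/-- An `ε`-chain for `f` from `p` to `q`: a finite sequence `c 0 = p, …, c n = q`
with `n ≥ 1` and `dist (f (c i)) (c (i+1)) < ε` for all `i < n`. -/
def EChain {X : Type*} [MetricSpace X] (f : X → X) (ε : ℝ) (p q : X) : Prop :=
  ∃ (n : ℕ) (c : ℕ → X), 0 < n ∧ c 0 = p ∧ c n = q ∧
    ∀ i < n, dist (f (c i)) (c (i + 1)) < ε

/-- A point is chain recurrent if for every `ε > 0` there is an `ε`-chain from it to itself. -/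
def ChainRecurrent {X : Type*} [MetricSpace X] (f : X → X) (p : X) : Prop :=
  ∀ ε > 0, EChain f ε p p

/-- The chain recurrent set `ℛ(f)`. -/
def chainRecSet {X : Type*} [MetricSpace X] (f : X → X) : Set X :=
  {p | ChainRecurrent f p}

/-- The equivalence relation `∼` on the chain recurrent set: `p ∼ q` iff for every
`ε > 0` there are `ε`-chains from `p` to `q` and from `q` to `p`. -/
def ChainEquiv {X : Type*} [MetricSpace X] (f : X → X) (p q : X) : Prop :=
  p ∈ chainRecSet f ∧ q ∈ chainRecSet f ∧
    ∀ ε > 0, EChain f ε p q ∧ EChain f ε q p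

/-- The chain transitive component of a chain recurrent point `p`. -/
def chainComponent {X : Type*} [MetricSpace X] (f : X → X) (p : X) : Set X :=
  {q | ChainEquiv f p q}

namespace EChain

variable {X : Type*} [MetricSpace X] {f : X → X} {ε : ℝ} {p q r : X}

theorem trans (h : EChain f ε p q) (h' : EChain f ε q r) : EChain f ε p r := by
  obtain ⟨n, c, hn, c0, cn, hc⟩ := h
  obtain ⟨m, d, hm, d0, dm, hd⟩ := h'
  refine ⟨n + m, fun i => if i ≤ n then c i else d (i - n), by omega, by simp [c0], ?_,
    fun i hi => ?_⟩
  · simp [hm.ne', dm]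
  · rcases lt_trichotomy i n with h | rfl | h
    · simpa [h.le, Nat.succ_le_of_lt h] using hc i h
    · simpa [cn, ← d0] using hd 0 hm
    · have : i + 1 - n = i - n + 1 := by omega
      simpa [h.not_ge, (show ¬ i + 1 ≤ n by omega), this] using hd (i - n) (by omega)

theorem single (h : dist (f p) q < ε) : EChain f ε p q :=
  ⟨1, fun i => if i = 0 then p else q, one_pos, by simp, by simp, fun i hi => by
    obtain rfl : i = 0 := by omega
    simpa using h⟩

theorem exists_dist_lt (h : EChain f ε p q) :
    ∃ x, dist (f x) q < ε ∧ ∀ q', dist (f x) q' < ε → EChain f ε p q' := by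
  obtain ⟨n, c, hn, c0, cn, hc⟩ := h
  obtain ⟨n, rfl⟩ : ∃ k, n = k + 1 := ⟨n - 1, by omega⟩
  refine ⟨c n, cn ▸ hc n (by omega), fun q' hq' => ⟨n + 1, fun i => if i ≤ n then c i else q',
    hn, by simp [c0], by simp, fun i hi => ?_⟩⟩
  rcases Nat.lt_succ_iff_lt_or_eq.1 hi with h | rfl
  · simpa [h.le, Nat.succ_le_of_lt h] using hc i hi
  · simpa using hq'

theorem of_dist_image_lt {δ : ℝ} (h : EChain f δ p q) {p' : X} (hp : dist (f p') (f p) + δ ≤ ε) :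
    EChain f ε p' q := by
  obtain ⟨n, c, hn, c0, cn, hc⟩ := h
  refine ⟨n, fun i => if i = 0 then p' else c i, hn, by simp, by simp [hn.ne', cn],
    fun i hi => ?_⟩
  by_cases h : i = 0
  · subst h
    have := hc 0 hi
    rw [c0] at this
    simpa using (dist_triangle _ (f p) _).trans_lt (by linarith)
  · simp only [h, if_false, Nat.succ_ne_zero]
    exact (hc i hi).trans_le (by linarith [dist_nonneg (x := f p') (y := f p)])

/-- The points of a connected set of chain recurrent points are chain equivalent. -/
theorem of_isPreconnected (hf : Continuous f) {s : Set X} (hs : IsPreconnected s)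
    (hsR : s ⊆ chainRecSet f) (hε : 0 < ε) (hp : p ∈ s) (hq : q ∈ s) : EChain f ε p q := by
  have key : ∀ x ∈ s, ∀ y ∈ s, dist (f x) (f y) < ε / 2 → EChain f ε x y := fun x _ y hy h =>
    (hsR hy (ε / 2) (half_pos hε)).of_dist_image_lt (by linarith)
  refine hs.induction₂' (EChain f ε) (fun x hx => ?_) (fun x y z _ _ _ => trans) hp hq
  · have h1 : ∀ᶠ y in nhdsWithin x s, dist (f y) (f x) < ε / 2 :=
      nhdsWithin_le_nhds (hf.continuousAt.eventually (ball_mem_nhds _ (half_pos hε)))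
    filter_upwards [h1, self_mem_nhdsWithin] with y hy hys
    exact ⟨key x hx y hys (by rwa [dist_comm]), key y hys x hx hy⟩

end EChain

/-- If no `ε`-chain leads from `S` to `T`, the set of points reachable from `S` is an open
set which contains the image of its closure. -/
theorem exists_isOpen_image_closure_subset {X : Type*} [MetricSpace X] {f : X → X}
    (hf : Continuous f) {S T : Set X} (hS : IsPreconnected S) (hT : IsPreconnected T)
    (hSR : S ⊆ chainRecSet f) (hTR : T ⊆ chainRecSet f) {p q : X} (hp : p ∈ S) (hq : q ∈ T)
    {ε : ℝ} (hε : 0 < ε) (h : ¬ EChain f ε p q) :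
    ∃ U : Set X, IsOpen U ∧ S ⊆ U ∧ Disjoint U T ∧ f '' closure U ⊆ U := by
  refine ⟨{y | EChain f ε p y}, isOpen_iff_mem_nhds.2 fun y hy => ?_,
    fun y hy => EChain.of_isPreconnected hf hS hSR hε hp hy,
    Set.disjoint_left.2 fun y hy hyT =>
      h (EChain.trans hy (EChain.of_isPreconnected hf hT hTR hε hyT hq)), ?_⟩
  · obtain ⟨x, hx, hx'⟩ := EChain.exists_dist_lt hy
    filter_upwards [isOpen_ball.mem_nhds (show y ∈ ball (f x) ε by rwa [mem_ball, dist_comm])]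
      with z hz
    exact hx' z (by rwa [dist_comm])
  · rintro _ ⟨x, hx, rfl⟩
    obtain ⟨y, hy, hyU⟩ := mem_closure_iff_nhds.1 hx _
      (hf.continuousAt.preimage_mem_nhds (ball_mem_nhds (f x) hε))
    exact EChain.trans hyU (EChain.single hy)

/-- A circle map with a lift that does not close up is not null-homotopic. -/
theorem not_nullhomotopic_of_lift (g : C(S1, S1)) (ψ : ℝ → ℝ) (hψ : ContinuousOn ψ (Icc 0 1))
    (h : ∀ t ∈ Icc (0 : ℝ) 1, g (t : S1) = (ψ t : S1)) (h01 : ψ 0 ≠ ψ 1) :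
    ¬ g.Nullhomotopic := by
  rintro ⟨y, ⟨H⟩⟩
  have cov := AddCircle.isCoveringMap_coe (1 : ℝ)
  obtain ⟨y', rfl⟩ := QuotientAddGroup.mk_surjective y
  have H0 : ∀ a, H.symm.toContinuousMap (0, a) = ((ContinuousMap.const S1 y' a : ℝ) : S1) :=
    fun a => H.symm.apply_zero a
  let G := cov.liftHomotopy H.symm.toContinuousMap (ContinuousMap.const S1 y') H0
  have hG : ∀ a, ((G (1, a) : ℝ) : S1) = g a := fun a =>
    (congr_fun (cov.liftHomotopy_lifts H.symm.toContinuousMap _ H0) (1, a)).trans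
      (H.symm.apply_one a)
  have hc : ContinuousOn (fun t : ℝ => ψ t - G (1, (t : S1))) (Icc 0 1) := by
    refine hψ.sub (Continuous.continuousOn ?_)
    exact G.continuous.comp (continuous_const.prodMk (AddCircle.continuous_mk' 1))
  have hZ : ∀ t ∈ Icc (0 : ℝ) 1, ∃ m : ℤ, (m : ℝ) = ψ t - G (1, (t : S1)) := fun t ht => by
    have : ((ψ t - G (1, (t : S1)) : ℝ) : S1) = 0 := by
      rw [AddCircle.coe_sub, hG, h t ht, sub_self]
    simpa using (AddCircle.coe_eq_zero_iff 1).1 this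
  have h1 := isPreconnected_Icc.constant_of_mapsTo
    Int.isClosedEmbedding_coe_real.isInducing.isDiscrete_range hc hZ
    (left_mem_Icc.2 zero_le_one) (right_mem_Icc.2 zero_le_one)
  have e : ((1 : ℝ) : S1) = ((0 : ℝ) : S1) := by simp
  simp only [e] at h1
  exact h01 (sub_left_injective h1)

/-- A finite chain of `n` steps along the relation `R`. -/
def StepChain {E : Type*} (R : E → E → Prop) : ℕ → E → E → Prop
  | 0, a, b => a = b
  | n + 1, a, c => ∃ b, StepChain R n a b ∧ R b c

namespace StepChain

variable {E : Type*} {R : E → E → Prop}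

theorem single {a b : E} (h : R a b) : StepChain R 1 a b := ⟨a, rfl, h⟩

theorem trans {n m : ℕ} {a b c : E} (h : StepChain R n a b) (h' : StepChain R m b c) :
    StepChain R (n + m) a c := by
  induction m generalizing c with
  | zero => obtain rfl : b = c := h'; exact h
  | succ m ih => obtain ⟨d, hd, hr⟩ := h'; exact ⟨d, ih hd, hr⟩

theorem of_forall {v : ℕ → E} (hv : ∀ i, R (v i) (v (i + 1))) (i l : ℕ) :
    StepChain R l (v i) (v (i + l)) := by
  induction l with
  | zero => rfl
  | succ l ih => exact ⟨_, ih, hv (i + l)⟩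

theorem exists_vertices {n : ℕ} {a b : E} (h : StepChain R n a b) :
    ∃ c : ℕ → E, c 0 = a ∧ c n = b ∧ ∀ i < n, R (c i) (c (i + 1)) := by
  induction n generalizing b with
  | zero => obtain rfl : a = b := h; exact ⟨fun _ => a, rfl, rfl, by simp⟩
  | succ n ih =>
    obtain ⟨d, hd, hr⟩ := h
    obtain ⟨c, h0, hn, hc⟩ := ih hd
    refine ⟨fun i => if i ≤ n then c i else b, by simp [h0], by simp, fun i hi => ?_⟩
    rcases Nat.lt_succ_iff_lt_or_eq.1 hi with hi | rfl
    · simpa [hi.le, Nat.succ_le_of_lt hi] using hc i hi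
    · simpa [hn] using hr

theorem exists_of_reflTransGen {a b : E} (h : Relation.ReflTransGen R a b) :
    ∃ n, StepChain R n a b := by
  induction h with
  | refl => exact ⟨0, rfl⟩
  | tail _ hr ih => obtain ⟨n, hn⟩ := ih; exact ⟨n + 1, _, hn, hr⟩

end StepChain

/-- The deck translation vector `(k, 0)`. -/
def deck (k : ℤ) : ℝ × ℝ := ((k : ℝ), 0)

@[simp] theorem deck_zero : deck 0 = 0 := by simp [deck]

theorem deck_add (k l : ℤ) : deck (k + l) = deck k + deck l := by simp [deck]

theorem deck_sub (k l : ℤ) : deck (k - l) = deck k - deck l := by simp [deck]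

theorem deck_injective : Function.Injective deck := fun k l h => by
  simpa [deck] using h

/-- Two points are linked in `W` if the segment joining them is in `W` and is narrower
than half a period. -/
def IsLink (W : Set (ℝ × ℝ)) (a b : ℝ × ℝ) : Prop :=
  segment ℝ a b ⊆ W ∧ |a.1 - b.1| < 1 / 2

namespace IsLink

variable {W : Set (ℝ × ℝ)} {a b : ℝ × ℝ}

theorem symm (h : IsLink W a b) : IsLink W b a :=
  ⟨by rw [segment_symm]; exact h.1, by rw [abs_sub_comm]; exact h.2⟩

theorem add_deck (hW : ∀ x ∈ W, ∀ k : ℤ, x + deck k ∈ W) (h : IsLink W a b) (k : ℤ) :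
    IsLink W (a + deck k) (b + deck k) := by
  refine ⟨fun x hx => ?_, by simpa using h.2⟩
  have : x - deck k ∈ segment ℝ a b := by
    rw [← mem_segment_translate ℝ (deck k)]
    simpa [add_comm] using hx
  simpa using hW _ (h.1 this) k

theorem of_mem_segment {p q : ℝ × ℝ} (h : IsLink W a b) (hp : p ∈ segment ℝ a b)
    (hq : q ∈ segment ℝ a b) : IsLink W p q := by
  refine ⟨((convex_segment a b).segment_subset hp hq).trans h.1, ?_⟩
  rw [segment_eq_image_lineMap] at hp hq
  obtain ⟨s, hs, rfl⟩ := hp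
  obtain ⟨t, ht, rfl⟩ := hq
  have h2 := h.2
  have e : (AffineMap.lineMap a b s : ℝ × ℝ).1 - (AffineMap.lineMap a b t : ℝ × ℝ).1
      = (t - s) * (a.1 - b.1) := by
    simp [AffineMap.lineMap_apply]; ring
  rw [e, abs_mul]
  have : |t - s| ≤ 1 := abs_le.2 ⟨by linarith [hs.2, ht.1], by linarith [hs.1, ht.2]⟩
  nlinarith [abs_nonneg (a.1 - b.1), abs_nonneg (t - s)]

end IsLink

/-- The polygonal path through the vertices `v 0, v 1, …`. -/
def polyline (v : ℕ → ℝ × ℝ) (t : ℝ) : ℝ × ℝ :=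
  AffineMap.lineMap (v ⌊t⌋₊) (v (⌊t⌋₊ + 1)) (t - ⌊t⌋₊)

theorem polyline_eq_lineMap (v : ℕ → ℝ × ℝ) {i : ℕ} {t : ℝ} (ht : t ∈ Icc (i : ℝ) (i + 1)) :
    polyline v t = AffineMap.lineMap (v i) (v (i + 1)) (t - i) := by
  rcases ht.2.lt_or_eq with h | rfl
  · have : ⌊t⌋₊ = i := (Nat.floor_eq_iff (i.cast_nonneg.trans ht.1)).2 ⟨ht.1, h⟩
    simp [polyline, this]
  · have : ⌊(i : ℝ) + 1⌋₊ = i + 1 := by 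
      exact_mod_cast Nat.floor_natCast (R := ℝ) (i + 1)
    simp [polyline, this]

theorem continuousOn_polyline (v : ℕ → ℝ × ℝ) (n : ℕ) :
    ContinuousOn (polyline v) (Icc (0 : ℝ) n) := by
  induction n with
  | zero => simp
  | succ n ih =>
    have h : Icc (0 : ℝ) ((n + 1 : ℕ) : ℝ) = Icc 0 (n : ℝ) ∪ Icc (n : ℝ) (n + 1) := by
      rw [Icc_union_Icc_eq_Icc n.cast_nonneg (by simp)]; simp
    rw [h]
    refine ih.union_of_isClosed ?_ isClosed_Icc isClosed_Icc
    refine ContinuousOn.congr (f := fun t : ℝ => AffineMap.lineMap (v n) (v (n + 1)) (t - n)) ?_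
      fun t ht => polyline_eq_lineMap v ht
    simp only [AffineMap.lineMap_apply]
    fun_prop

theorem sub_natFloor_mem_Ico {t : ℝ} (ht : 0 ≤ t) : t - (⌊t⌋₊ : ℝ) ∈ Ico (0 : ℝ) 1 :=
  ⟨sub_nonneg.2 (Nat.floor_le ht), sub_lt_iff_lt_add'.2 (Nat.lt_floor_add_one t)⟩

theorem isLink_of_lineMap_eq {W : Set (ℝ × ℝ)} {a b d : ℝ × ℝ} (hab : IsLink W a b)
    (hbd : IsLink W b d) {s t : ℝ} (hs : s < 1) (ht : 0 ≤ t)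
    (h : (AffineMap.lineMap a b s : ℝ × ℝ) = AffineMap.lineMap b d t) : IsLink W a d := by
  have h' : (1 - s) • (a - b) = t • (d - b) := by
    simp only [AffineMap.lineMap_apply, vsub_eq_sub, vadd_eq_add] at h
    have h2 : (1 - s) • (a - b) = (s • (b - a) + a) - b := by module
    rw [h2, h]; module
  have hs' : 0 < 1 - s := by linarith
  rcases le_or_gt t (1 - s) with hle | hlt
  · refine hbd.of_mem_segment ?_ (right_mem_segment ℝ b d)
    rw [segment_eq_image_lineMap]
    refine ⟨t / (1 - s), ⟨by positivity, (div_le_one hs').2 hle⟩, ?_⟩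
    simp only [AffineMap.lineMap_apply, vsub_eq_sub, vadd_eq_add]
    rw [div_eq_inv_mul, mul_smul, ← h', smul_smul, inv_mul_cancel₀ hs'.ne']
    simp
  · have ht' : 0 < t := hs'.trans hlt
    refine hab.of_mem_segment (left_mem_segment ℝ a b) ?_
    rw [segment_symm, segment_eq_image_lineMap]
    refine ⟨(1 - s) / t, ⟨by positivity, (div_le_one ht').2 hlt.le⟩, ?_⟩
    simp only [AffineMap.lineMap_apply, vsub_eq_sub, vadd_eq_add]
    rw [div_eq_inv_mul, mul_smul, h', smul_smul, inv_mul_cancel₀ ht'.ne']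
    simp

theorem StepChain.abs_fst_sub_lt_one {W : Set (ℝ × ℝ)} {n : ℕ} (hn : n ≤ 2) {a b : ℝ × ℝ}
    (h : StepChain (IsLink W) n a b) : |a.1 - b.1| < 1 := by
  have hl : ∀ {x y}, IsLink W x y → -(1 / 2) < x.1 - y.1 ∧ x.1 - y.1 < 1 / 2 :=
    fun h => abs_lt.1 h.2
  interval_cases n
  · obtain rfl : a = b := h
    simp
  · obtain ⟨x, rfl, h1⟩ := h
    exact abs_lt.2 ⟨by linarith [hl h1], by linarith [hl h1]⟩
  · obtain ⟨x, ⟨y, rfl, h1⟩, h2⟩ := h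
    exact abs_lt.2 ⟨by linarith [hl h1, hl h2], by linarith [hl h1, hl h2]⟩

/-- A periodic polygonal line whose links lie in `W`, which closes up after `n` links in the
quotient, `n` being the least number of links of a closed polygonal line with nonzero
displacement. -/
structure IsMinimalPolygon (W : Set (ℝ × ℝ)) (n : ℕ) (k : ℤ) (v : ℕ → ℝ × ℝ) : Prop where
  translate : ∀ x ∈ W, ∀ k : ℤ, x + deck k ∈ W
  displacement_ne_zero : k ≠ 0
  periodic : ∀ i, v (i + n) = v i + deck k
  link : ∀ i, IsLink W (v i) (v (i + 1))
  eq_zero_of_lt : ∀ l < n, ∀ (a : ℝ × ℝ) (m : ℤ), StepChain (IsLink W) l a (a + deck m) → m = 0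

theorem exists_isMinimalPolygon {W : Set (ℝ × ℝ)} (hW : ∀ x ∈ W, ∀ k : ℤ, x + deck k ∈ W)
    (h : ∃ n a k, k ≠ 0 ∧ StepChain (IsLink W) n a (a + deck k)) :
    ∃ n k v, IsMinimalPolygon W n k v := by
  classical
  obtain ⟨a, k, hk, hc⟩ := Nat.find_spec h
  set n := Nat.find h with hn
  have hmin : ∀ l < n, ∀ (a : ℝ × ℝ) (m : ℤ), StepChain (IsLink W) l a (a + deck m) → m = 0 := by
    intro l hl a m hm
    by_contra h0
    exact Nat.find_min h hl ⟨a, m, h0, hm⟩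
  have hpos : 0 < n := by
    refine Nat.pos_of_ne_zero fun h0 => hk ?_
    rw [h0] at hc
    have : a = a + deck k := hc
    exact deck_injective (by simpa using this)
  obtain ⟨c, c0, cn, hc⟩ := hc.exists_vertices
  refine ⟨n, k, fun i => c (i % n) + deck (k * (i / n : ℕ)), hW, hk, fun i => ?_, fun i => ?_,
    hmin⟩
  · simp only [Nat.add_mod_right, Nat.add_div_right _ hpos]
    rw [add_assoc, ← deck_add]
    push_cast
    ring_nf
  · have hi := hc (i % n) (Nat.mod_lt _ hpos)
    have key := hi.add_deck hW (k * (i / n : ℕ))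
    by_cases hlt : i % n + 1 < n
    · have h1 : (i + 1) % n = i % n + 1 := by
        rw [Nat.add_mod, Nat.mod_eq_of_lt (show 1 < n by omega), Nat.mod_eq_of_lt hlt]
      have h2 : (i + 1) / n = i / n := by
        rw [Nat.succ_div, if_neg, add_zero]
        rw [Nat.dvd_iff_mod_eq_zero, h1]; omega
      simpa only [h1, h2] using key
    · have h0 : i % n + 1 = n := by have := Nat.mod_lt i hpos; omega
      have h1 : n ∣ i + 1 := ⟨i / n + 1, by have := Nat.mod_add_div i n; rw [mul_add]; omega⟩
      have h2 : (i + 1) / n = i / n + 1 := by rw [Nat.succ_div, if_pos h1]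
      have h3 : (i + 1) % n = 0 := Nat.mod_eq_zero_of_dvd h1
      simp only [h2, h3]
      rw [h0, cn] at key
      convert key using 1
      rw [c0, add_assoc, ← deck_add]
      push_cast
      ring_nf

namespace IsMinimalPolygon

variable {W : Set (ℝ × ℝ)} {n : ℕ} {k : ℤ} {v : ℕ → ℝ × ℝ}

theorem three_le (h : IsMinimalPolygon W n k v) : 3 ≤ n := by
  by_contra hn
  have h1 := StepChain.of_forall h.link 0 n
  rw [h.periodic] at h1
  have h2 := h1.abs_fst_sub_lt_one (by omega)
  have h3 : (1 : ℝ) ≤ |(k : ℝ)| := by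
    exact_mod_cast Int.one_le_abs h.displacement_ne_zero
  simp [deck] at h2
  linarith

theorem not_isLink (h : IsMinimalPolygon W n k v) (i : ℕ) : ¬ IsLink W (v i) (v (i + 2)) := by
  intro hl
  have hn := h.three_le
  have h1 := (StepChain.single hl).trans (StepChain.of_forall h.link (i + 2) (n - 2))
  rw [show i + 2 + (n - 2) = i + n by omega, h.periodic] at h1
  exact h.displacement_ne_zero (h.eq_zero_of_lt _ (by omega) _ _ h1)

theorem ne_succ (h : IsMinimalPolygon W n k v) (i : ℕ) : v i ≠ v (i + 1) := fun he =>
  h.not_isLink i (he ▸ h.link (i + 1))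

theorem lineMap_ne_of_near (h : IsMinimalPolygon W n k v) {i j : ℕ} {s t : ℝ} (hij : i ≤ j)
    (hji : j ≤ i + 1) (hs : s ∈ Ico (0 : ℝ) 1) (ht : t ∈ Ico (0 : ℝ) 1)
    (hst : i + s < j + t) (m : ℤ) :
    (AffineMap.lineMap (v j) (v (j + 1)) t : ℝ × ℝ) ≠
      AffineMap.lineMap (v i) (v (i + 1)) s + deck m := by
  intro he
  have hn := h.three_le
  have hP := lineMap_mem_segment ℝ (v i) (v (i + 1)) (Ico_subset_Icc_self hs)
  have hQ := lineMap_mem_segment ℝ (v j) (v (j + 1)) (Ico_subset_Icc_self ht)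
  rcases hij.eq_or_lt with rfl | hlt
  · have h1 := StepChain.single ((h.link i).of_mem_segment hP hQ)
    rw [he] at h1
    obtain rfl := h.eq_zero_of_lt _ (by omega) _ _ h1
    rw [deck_zero, add_zero] at he
    exact (by linarith : s < t).ne' (AffineMap.lineMap_injective ℝ (h.ne_succ i) he)
  · obtain rfl : j = i + 1 := by omega
    have h1 := (StepChain.single ((h.link i).of_mem_segment hP (right_mem_segment ℝ _ _))).trans
      (StepChain.single ((h.link (i + 1)).of_mem_segment (left_mem_segment ℝ _ _) hQ))
    rw [he] at h1
    obtain rfl := h.eq_zero_of_lt _ (by omega) _ _ h1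
    rw [deck_zero, add_zero] at he
    exact h.not_isLink i (isLink_of_lineMap_eq (h.link i) (h.link (i + 1)) hs.2 ht.1 he.symm)

theorem polyline_ne_of_lt (h : IsMinimalPolygon W n k v) {s t : ℝ} (hs : 0 ≤ s) (hst : s < t)
    (ht : t < n) (m : ℤ) : polyline v t ≠ polyline v s + deck m := by
  intro he
  have hs' := sub_natFloor_mem_Ico hs
  have ht' := sub_natFloor_mem_Ico (hs.trans hst.le)
  have hij : ⌊s⌋₊ ≤ ⌊t⌋₊ := Nat.floor_mono hst.le
  have hjn : ⌊t⌋₊ < n := (Nat.floor_lt (hs.trans hst.le)).2 ht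
  have hP := lineMap_mem_segment ℝ (v ⌊s⌋₊) (v (⌊s⌋₊ + 1)) (Ico_subset_Icc_self hs')
  have hQ := lineMap_mem_segment ℝ (v ⌊t⌋₊) (v (⌊t⌋₊ + 1)) (Ico_subset_Icc_self ht')
  unfold polyline at he
  set i := ⌊s⌋₊
  set j := ⌊t⌋₊
  by_cases hnear : j ≤ i + 1
  · exact h.lineMap_ne_of_near hij hnear hs' ht' (by linarith) m he
  set P : ℝ × ℝ := AffineMap.lineMap (v i) (v (i + 1)) (s - i) with hPdef
  set Q : ℝ × ℝ := AffineMap.lineMap (v j) (v (j + 1)) (t - j) with hQdef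
  have hPk : P + deck k = Q + deck (k - m) := by rw [he, deck_sub]; abel
  have hper : (AffineMap.lineMap (v (i + n)) (v (i + n + 1)) (s - i) : ℝ × ℝ) = P + deck k := by
    rw [show i + n + 1 = i + 1 + n by omega, h.periodic, h.periodic, hPdef]
    simp only [AffineMap.lineMap_apply, vsub_eq_sub, vadd_eq_add]
    module
  by_cases hfar : i + n ≤ j + 1
  · refine h.lineMap_ne_of_near (by omega) hfar ht' hs' ?_ (k - m) (hper.trans hPk)
    push_cast
    linarith
  have hPk' := lineMap_mem_segment ℝ (v (i + n)) (v (i + n + 1)) (Ico_subset_Icc_self hs')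
  rw [hper] at hPk'
  have hA := ((StepChain.single ((h.link i).of_mem_segment hP (right_mem_segment ℝ _ _))).trans
    (StepChain.of_forall h.link (i + 1) (j - i - 1)))
  rw [show i + 1 + (j - i - 1) = j by omega] at hA
  have hA' := hA.trans
    (StepChain.single ((h.link j).of_mem_segment (left_mem_segment ℝ _ _) hQ))
  rw [he] at hA'
  have hm := h.eq_zero_of_lt _ (by omega) _ _ hA'
  have hB := ((StepChain.single ((h.link j).of_mem_segment hQ (right_mem_segment ℝ _ _))).trans
    (StepChain.of_forall h.link (j + 1) (i + n - j - 1)))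
  rw [show j + 1 + (i + n - j - 1) = i + n by omega] at hB
  have hB' := hB.trans
    (StepChain.single ((h.link (i + n)).of_mem_segment (left_mem_segment ℝ _ _) hPk'))
  rw [hPk] at hB'
  have hkm := h.eq_zero_of_lt _ (by omega) _ _ hB'
  exact h.displacement_ne_zero (by omega)

theorem polyline_mem (h : IsMinimalPolygon W n k v) {t : ℝ} (ht : 0 ≤ t) : polyline v t ∈ W :=
  (h.link _).1 (lineMap_mem_segment ℝ _ _ (Ico_subset_Icc_self (sub_natFloor_mem_Ico ht)))

theorem polyline_natCast (v : ℕ → ℝ × ℝ) (i : ℕ) : polyline v i = v i := by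
  simp [polyline]

end IsMinimalPolygon

/-- The map `ℝ × ℝ → 𝔸` which restricts to the universal covering on the strip. -/
def annProj (x : ℝ × ℝ) : Ann := ((x.1 : S1), Set.projIcc 0 1 zero_le_one x.2)

theorem continuous_annProj : Continuous annProj :=
  ((AddCircle.continuous_mk' 1).comp continuous_fst).prodMk
    (continuous_projIcc.comp continuous_snd)

theorem annProj_add_deck (x : ℝ × ℝ) (k : ℤ) : annProj (x + deck k) = annProj x := by
  simp [annProj, deck]

theorem exists_eq_add_deck {x y : ℝ × ℝ} (hx : x.2 ∈ Icc (0 : ℝ) 1) (hy : y.2 ∈ Icc (0 : ℝ) 1)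
    (h : annProj x = annProj y) : ∃ k : ℤ, x = y + deck k := by
  obtain ⟨h1, h2⟩ := Prod.ext_iff.1 h
  have h3 : ((x.1 - y.1 : ℝ) : S1) = 0 := by
    rw [AddCircle.coe_sub]; exact sub_eq_zero.2 h1
  obtain ⟨k, hk⟩ := (AddCircle.coe_eq_zero_iff 1).1 h3
  refine ⟨k, Prod.ext ?_ ?_⟩
  · simp [deck] at hk ⊢; linarith
  · rw [annProj, annProj, projIcc_of_mem _ hx, projIcc_of_mem _ hy] at h2
    simpa [deck] using h2

theorem exists_essential_curve_of_isMinimalPolygon {W : Set (ℝ × ℝ)} {n : ℕ} {k : ℤ}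
    {v : ℕ → ℝ × ℝ} (h : IsMinimalPolygon W n k v) (hW : ∀ x ∈ W, x.2 ∈ Icc (0 : ℝ) 1) :
    ∃ γ : C(S1, Ann), IsEssentialCurve γ ∧ Set.range γ ⊆ annProj '' W := by
  have hn : (0 : ℝ) < n := by exact_mod_cast (show 0 < n by have := h.three_le; omega)
  let X : ℝ → ℝ × ℝ := fun t => polyline v (n * t)
  have hX : ContinuousOn X (Icc 0 1) :=
    (continuousOn_polyline v n).comp (continuous_const.mul continuous_id).continuousOn
      fun t ht => ⟨mul_nonneg hn.le ht.1, mul_le_of_le_one_right hn.le ht.2⟩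
  have hX1 : X 1 = X 0 + deck k := by
    have h1 := IsMinimalPolygon.polyline_natCast v n
    have h0 := IsMinimalPolygon.polyline_natCast v 0
    have hp := h.periodic 0
    rw [Nat.cast_zero] at h0
    rw [zero_add] at hp
    simp only [X, mul_one, mul_zero]
    rw [h1, h0, hp]
  have hXW : ∀ t, 0 ≤ t → X t ∈ W := fun t ht => h.polyline_mem (mul_nonneg hn.le ht)
  have hcl : annProj (X 0) = annProj (X 1) := by rw [hX1, annProj_add_deck]
  let γ : C(S1, Ann) := ⟨AddCircle.liftIco 1 0 (annProj ∘ X), AddCircle.liftIco_continuous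
    (by simpa using hcl) (by rw [zero_add]; exact continuous_annProj.comp_continuousOn hX)⟩
  have hγ : ∀ t ∈ Ico (0 : ℝ) 1, γ (t : S1) = annProj (X t) := fun t ht =>
    AddCircle.liftIco_zero_coe_apply (f := annProj ∘ X) ht
  have hrep : ∀ θ : S1, ∃ t ∈ Ico (0 : ℝ) 1, (t : S1) = θ := fun θ =>
    ⟨_, by simpa using (AddCircle.equivIco 1 0 θ).2, AddCircle.coe_equivIco⟩
  have hlt : ∀ s t : ℝ, 0 ≤ s → s < t → t < 1 → annProj (X t) ≠ annProj (X s) := by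
    intro s t hs hst ht he
    obtain ⟨m, hm⟩ := exists_eq_add_deck (hW _ (hXW _ (hs.trans hst.le))) (hW _ (hXW _ hs)) he
    exact h.polyline_ne_of_lt (mul_nonneg hn.le hs) (mul_lt_mul_of_pos_left hst hn)
      (mul_lt_of_lt_one_right hn ht) m hm
  refine ⟨γ, ⟨fun θ θ' he => ?_, fun hnull => ?_⟩, ?_⟩
  · obtain ⟨s, hs, rfl⟩ := hrep θ
    obtain ⟨t, ht, rfl⟩ := hrep θ'
    rw [hγ s hs, hγ t ht] at he
    rcases lt_trichotomy s t with hst | rfl | hst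
    · exact (hlt s t hs.1 hst ht.2 he.symm).elim
    · rfl
    · exact (hlt t s ht.1 hst hs.2 he).elim
  · refine not_nullhomotopic_of_lift (ContinuousMap.fst.comp γ) (fun t => (X t).1)
      (continuous_fst.comp_continuousOn hX) (fun t ht => ?_) ?_ (hnull.comp_right _)
    · rcases ht.2.lt_or_eq with h1 | rfl
      · exact congrArg Prod.fst (hγ t ⟨ht.1, h1⟩)
      · have e : ((1 : ℝ) : S1) = ((0 : ℝ) : S1) := by simp
        rw [e]
        exact congrArg Prod.fst ((hγ 0 ⟨le_rfl, zero_lt_one⟩).trans hcl)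
    · simp [hX1, deck, h.displacement_ne_zero]
  · rintro _ ⟨θ, rfl⟩
    obtain ⟨t, ht, rfl⟩ := hrep θ
    exact ⟨X t, hXW t ht.1, (hγ t ht).symm⟩

/-- If no closed polygonal line has nonzero displacement, there is an equivariant integer
valued function which is constant along links. -/
theorem exists_deck_potential {W : Set (ℝ × ℝ)} (hW : ∀ x ∈ W, ∀ k : ℤ, x + deck k ∈ W)
    (h : ∀ n a k, StepChain (IsLink W) n a (a + deck k) → k = 0) :
    ∃ m : ℝ × ℝ → ℤ, (∀ x y, IsLink W x y → m x = m y) ∧ ∀ x, m (x + deck 1) = m x - 1 := by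
  have hclosed : ∀ a k l, Relation.ReflTransGen (IsLink W) (a + deck k) (a + deck l) → k = l := by
    intro a k l hr
    obtain ⟨n, hn⟩ := StepChain.exists_of_reflTransGen hr
    have := h n (a + deck k) (l - k) (by rwa [add_assoc, ← deck_add, add_sub_cancel])
    omega
  have hsymm : ∀ {a b}, Relation.ReflTransGen (IsLink W) a b →
      Relation.ReflTransGen (IsLink W) b a := fun h => by
    have : Std.Symm (IsLink W) := ⟨fun _ _ => IsLink.symm⟩
    exact Relation.ReflTransGen.stdSymm.symm _ _ h
  have hadd : ∀ {a b} (k : ℤ), Relation.ReflTransGen (IsLink W) a b →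
      Relation.ReflTransGen (IsLink W) (a + deck k) (b + deck k) := fun k h =>
    h.lift (· + deck k) fun _ _ hl => hl.add_deck hW k
  let S : Setoid (ℝ × ℝ) :=
    { r := fun x y => ∃ k : ℤ, Relation.ReflTransGen (IsLink W) (x + deck k) y
      iseqv :=
        { refl := fun x => ⟨0, by simpa using Relation.ReflTransGen.refl⟩
          symm := fun {x y} ⟨k, hk⟩ => ⟨-k, by
            have := hadd (-k) (hsymm hk)
            rwa [add_assoc, ← deck_add, add_neg_cancel, deck_zero, add_zero] at this⟩
          trans := fun {x y z} ⟨k, hk⟩ ⟨l, hl⟩ => ⟨k + l, by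
            have := hadd l hk
            rw [add_assoc, ← deck_add] at this
            exact this.trans hl⟩ } }
  have hout : ∀ x, ∃ k : ℤ,
      Relation.ReflTransGen (IsLink W) (x + deck k) (Quotient.out (Quotient.mk S x)) :=
    fun x => Setoid.symm (Quotient.mk_out x)
  choose m hm using hout
  have hrep : ∀ {x y} (k : ℤ), Relation.ReflTransGen (IsLink W) (x + deck k) y →
      m x = k + m y := by
    intro x y k hxy
    have e : Quotient.mk S x = Quotient.mk S y := Quotient.sound ⟨k, hxy⟩
    have h1 := hm x
    rw [e] at h1
    have h2 := hadd (m y) hxy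
    rw [add_assoc, ← deck_add] at h2
    exact hclosed x _ _ (h1.trans (hsymm (h2.trans (hm y))))
  refine ⟨m, fun x y hl => ?_, fun x => ?_⟩
  · have := hrep (x := x) (y := y) 0 (by simpa using Relation.ReflTransGen.single hl)
    omega
  · have := hrep (x := x) (y := x + deck 1) 1 Relation.ReflTransGen.refl
    omega

theorem eventually_isLink {W : Set (ℝ × ℝ)} (hW : IsOpen W) {x : ℝ × ℝ} (hx : x ∈ W) :
    ∀ᶠ y in nhds x, IsLink W x y := by
  obtain ⟨r, hr, hball⟩ := Metric.isOpen_iff.1 hW x hx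
  filter_upwards [Metric.ball_mem_nhds x hr, Metric.ball_mem_nhds x (half_pos zero_lt_one)]
    with y hy hlt
  refine ⟨((convex_ball x r).segment_subset (mem_ball_self hr) hy).trans hball, ?_⟩
  rw [mem_ball', Prod.dist_eq] at hlt
  exact (le_max_left _ _).trans_lt hlt

/-- The part of the open strip on which `u` lies strictly between `0` and `1`. -/
def transitionStrip (u : Ann → ℝ) : Set (ℝ × ℝ) :=
  {x | x.2 ∈ Ioo (0 : ℝ) 1 ∧ u (annProj x) ∈ Ioo (0 : ℝ) 1}

theorem exists_closed_chain {u : Ann → ℝ} (hu : Continuous u) (hu0 : ∀ p ∈ A0, u p = 0)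
    (hu1 : ∀ p ∈ A1, u p = 1) :
    ∃ n a k, k ≠ 0 ∧ StepChain (IsLink (transitionStrip u)) n a (a + deck k) := by
  by_contra! hcon
  have hW : ∀ x ∈ transitionStrip u, ∀ k : ℤ, x + deck k ∈ transitionStrip u := fun x hx k =>
    ⟨by simpa [deck] using hx.1, by rw [annProj_add_deck]; exact hx.2⟩
  have hWo : IsOpen (transitionStrip u) :=
    (isOpen_Ioo.preimage continuous_snd).inter
      (isOpen_Ioo.preimage (hu.comp continuous_annProj))
  obtain ⟨m, hm, hm1⟩ := exists_deck_potential hW fun n a k hc => by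
    by_contra hk
    exact hcon n a k hk hc
  let w : Ann → ℝ := fun p => max 0 (min 1 (3 * u p - 1))
  have hw : Continuous w := by fun_prop
  let e : ℝ × I01 → ℝ × ℝ := fun z => (z.1, z.2)
  have he : Continuous e := by fun_prop
  have hproj : ∀ z, annProj (e z) = annCover z := fun z => by
    simp [annProj, annCover, e]
  have hcov : Continuous annCover :=
    ((AddCircle.continuous_mk' 1).comp continuous_fst).prodMk continuous_snd
  let φ : ℝ × I01 → S1 := fun z => ((z.1 - w (annCover z) * (z.1 + m (e z)) : ℝ) : S1)
  have hφ : Continuous φ := by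
    refine continuous_iff_continuousAt.2 fun z => ?_
    have hcu : Continuous fun z => u (annCover z) := hu.comp hcov
    rcases lt_or_ge (u (annCover z)) (1 / 3) with h0 | h0
    · refine ContinuousAt.congr (f := fun z : ℝ × I01 => (z.1 : S1))
        ((AddCircle.continuous_mk' 1).comp continuous_fst).continuousAt ?_
      filter_upwards [hcu.continuousAt.eventually (gt_mem_nhds h0)] with y hy
      have : w (annCover y) = 0 :=
        max_eq_left ((min_le_right _ _).trans (by linarith))
      simp [φ, this]
    rcases lt_or_ge (2 / 3) (u (annCover z)) with h1 | h1
    · refine ContinuousAt.congr (f := fun _ => (0 : S1)) continuousAt_const ?_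
      filter_upwards [hcu.continuousAt.eventually (lt_mem_nhds h1)] with y hy
      have : w (annCover y) = 1 := by
        simp only [w]
        rw [min_eq_left (by linarith), max_eq_right zero_le_one]
      refine ((AddCircle.coe_eq_zero_iff 1).2 ⟨-m (e y), ?_⟩).symm
      simp [this]
    · have hz : e z ∈ transitionStrip u := by
        refine ⟨⟨lt_of_le_of_ne z.2.2.1 fun h => ?_, lt_of_le_of_ne z.2.2.2 fun h => ?_⟩,
          by rw [hproj]; constructor <;> linarith⟩
        · have := hu0 (annCover z) (Subtype.ext h.symm)
          linarith
        · have := hu1 (annCover z) (Subtype.ext h)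
          linarith
      refine ContinuousAt.congr
        (f := fun y : ℝ × I01 => ((y.1 - w (annCover y) * (y.1 + m (e z)) : ℝ) : S1)) ?_ ?_
      · have hww : Continuous fun y => w (annCover y) := hw.comp hcov
        exact ((AddCircle.continuous_mk' 1).comp
          (continuous_fst.sub (hww.mul (continuous_fst.add continuous_const)))).continuousAt
      · filter_upwards [he.continuousAt.eventually (eventually_isLink hWo hz)] with y hy
        simp only [φ, hm _ _ hy]
  have hper : ∀ (x : ℝ) (y : I01), φ (x + 1, y) = φ (x, y) := by
    intro x y
    have h1 : annCover (x + 1, y) = annCover (x, y) := by simp [annCover]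
    have h2 : e (x + 1, y) = e (x, y) + deck 1 := by simp [e, deck]
    simp only [φ, h1, h2, hm1]
    rw [← sub_eq_zero, ← AddCircle.coe_sub]
    refine (AddCircle.coe_eq_zero_iff 1).2 ⟨1, ?_⟩
    push_cast
    simp only [one_smul]
    ring
  have hq : IsOpenQuotientMap annCover :=
    (QuotientAddGroup.isOpenQuotientMap_mk (N := AddSubgroup.zmultiples (1 : ℝ))).prodMap
      IsOpenQuotientMap.id
  let Φ : S1 × I01 → S1 := fun p =>
    Function.Periodic.lift (f := fun x => φ (x, p.2)) (c := 1) (fun x => hper x p.2) p.1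
  have hΦ : ∀ z, Φ (annCover z) = φ z := fun z => rfl
  have hΦc : Continuous Φ := by
    rw [hq.isQuotientMap.continuous_iff]
    exact hφ.congr fun z => (hΦ z).symm
  have h0 : ∀ x : ℝ, φ (x, 0) = (x : S1) := by
    intro x
    have : w (annCover (x, 0)) = 0 := by
      simp [w, hu0 (annCover (x, 0)) rfl]
    simp [φ, this]
  have h1 : ∀ x : ℝ, φ (x, 1) = 0 := by
    intro x
    have : w (annCover (x, 1)) = 1 := by
      simp only [w, hu1 (annCover (x, 1)) rfl]
      norm_num
    refine (AddCircle.coe_eq_zero_iff 1).2 ⟨-m (e (x, 1)), ?_⟩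
    simp [this]
  refine not_nullhomotopic_of_lift (ContinuousMap.id S1) id continuousOn_id (fun t _ => rfl)
    zero_ne_one ⟨0, ⟨⟨⟨fun p => Φ (p.2, p.1), hΦc.comp continuous_swap⟩, fun θ => ?_,
      fun θ => ?_⟩⟩⟩
  · obtain ⟨x, rfl⟩ := QuotientAddGroup.mk_surjective θ
    exact (hΦ (x, 0)).trans (h0 x)
  · obtain ⟨x, rfl⟩ := QuotientAddGroup.mk_surjective θ
    exact (hΦ (x, 1)).trans (h1 x)

/-- Two disjoint closed sets containing the two boundary circles of the annulus are separated
by an essential simple closed curve. -/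
theorem exists_essential_curve_of_disjoint {K L : Set Ann} (hK : IsClosed K) (hL : IsClosed L)
    (hKL : Disjoint K L) (h0 : A0 ⊆ K) (h1 : A1 ⊆ L) :
    ∃ γ : C(S1, Ann), IsEssentialCurve γ ∧ Disjoint (Set.range γ) K ∧
      Disjoint (Set.range γ) L := by
  obtain ⟨u, huK, huL, -⟩ := exists_continuous_zero_one_of_isClosed hK hL hKL
  obtain ⟨n, k, v, hv⟩ := exists_isMinimalPolygon (W := transitionStrip u)
    (fun x hx k => ⟨by simpa [deck] using hx.1, by rw [annProj_add_deck]; exact hx.2⟩)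
    (exists_closed_chain u.continuous (fun p hp => huK (h0 hp)) fun p hp => huL (h1 hp))
  obtain ⟨γ, hγ, hr⟩ := exists_essential_curve_of_isMinimalPolygon hv
    fun x hx => Ioo_subset_Icc_self hx.1
  refine ⟨γ, hγ, Set.disjoint_left.2 fun p hp hpK => ?_, Set.disjoint_left.2 fun p hp hpL => ?_⟩
  · obtain ⟨x, hx, rfl⟩ := hr hp
    exact hx.2.1.ne' (huK hpK)
  · obtain ⟨x, hx, rfl⟩ := hr hp
    exact hx.2.2.ne (huL hpL)

theorem isPreconnected_circle (y : I01) : IsPreconnected {p : Ann | p.2 = y} := by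
  have : {p : Ann | p.2 = y} = Set.range fun θ : S1 => (θ, y) := by
    ext ⟨θ, z⟩
    simp [eq_comm]
  rw [this]
  exact isPreconnected_range (by fun_prop)

/-- An open set trapping the image of its closure which contains one of the two sets
`A₀`, `A₁` and misses the other yields an essential curve disjoint from its image. -/
theorem exists_essential_curve_of_trapping {f : Ann → Ann} (hf : Continuous f) {U : Set Ann}
    (hU : IsOpen U) (hfU : f '' closure U ⊆ U)
    (hA : A0 ⊆ U ∧ Disjoint U A1 ∨ A1 ⊆ U ∧ Disjoint U A0) :
    ∃ γ : C(S1, Ann), IsEssentialCurve γ ∧ f '' Set.range γ ∩ Set.range γ = ∅ := by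
  have himg : IsClosed (f '' closure U) := (isClosed_closure.isCompact.image hf).isClosed
  have key : ∀ S T : Set Ann, IsClosed S → S ⊆ U → Disjoint U T →
      IsClosed (f '' closure U ∪ S) ∧ Disjoint (f '' closure U ∪ S) Uᶜ ∧ T ⊆ Uᶜ :=
    fun S T hS hSU hUT => ⟨himg.union hS,
      Set.disjoint_compl_right_iff_subset.2 (Set.union_subset hfU hSU), hUT.symm.subset_compl_right⟩
  have hcl : ∀ y : I01, IsClosed {p : Ann | p.2 = y} := fun y =>
    isClosed_eq continuous_snd continuous_const
  have main : ∃ γ : C(S1, Ann), IsEssentialCurve γ ∧ Disjoint (Set.range γ) (f '' closure U) ∧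
      Disjoint (Set.range γ) Uᶜ := by
    rcases hA with ⟨hS, hT⟩ | ⟨hS, hT⟩
    · obtain ⟨h1, h2, h3⟩ := key A0 A1 (hcl _) hS hT
      obtain ⟨γ, hγ, hK, hL⟩ := exists_essential_curve_of_disjoint h1 hU.isClosed_compl h2
        Set.subset_union_right h3
      exact ⟨γ, hγ, hK.mono_right Set.subset_union_left, hL⟩
    · obtain ⟨h1, h2, h3⟩ := key A1 A0 (hcl _) hS hT
      obtain ⟨γ, hγ, hK, hL⟩ := exists_essential_curve_of_disjoint hU.isClosed_compl h1 h2.symm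
        h3 Set.subset_union_right
      exact ⟨γ, hγ, hL.mono_right Set.subset_union_left, hK⟩
  obtain ⟨γ, hγ, hK, hL⟩ := main
  refine ⟨γ, hγ, Set.disjoint_iff_inter_eq_empty.1 (hK.symm.mono_left ?_)⟩
  exact Set.image_mono ((Set.disjoint_compl_right_iff_subset.1 hL).trans subset_closure)

/-- If both boundary circles lie in the chain recurrent set of a homeomorphism `f`
of the annulus, but no point of `A₀` is chain equivalent to a point of `A₁` (i.e.
`A₀` and `A₁` do not lie in the same chain transitive component), then there is an
essential simple closed curve `γ` with `f(γ) ∩ γ = ∅`; in particular `f` fails the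
intersection property. -/
theorem exists_disjoint_essential_curve_of_boundaries_not_chain_equivalent
    (f : Ann ≃ₜ Ann)
    (h0 : A0 ⊆ chainRecSet ⇑f) (h1 : A1 ⊆ chainRecSet ⇑f)
    (hsep : ∀ p ∈ A0, ∀ q ∈ A1, ¬ ChainEquiv ⇑f p q) :
    (∃ γ : C(S1, Ann), IsEssentialCurve γ ∧ ⇑f '' Set.range γ ∩ Set.range γ = ∅) ∧
      ¬ IntersectionProperty ⇑f := by
  have main : ∃ γ : C(S1, Ann), IsEssentialCurve γ ∧ ⇑f '' Set.range γ ∩ Set.range γ = ∅ := by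
    obtain ⟨p, hp⟩ : A0.Nonempty := ⟨(0, iZero), rfl⟩
    obtain ⟨q, hq⟩ : A1.Nonempty := ⟨(0, iOne), rfl⟩
    have hpq : ∃ ε > 0, ¬ (EChain ⇑f ε p q ∧ EChain ⇑f ε q p) := by
      by_contra! h
      exact hsep p hp q hq ⟨h0 hp, h1 hq, h⟩
    obtain ⟨ε, hε, hpq⟩ := hpq
    have c0 : IsPreconnected A0 := isPreconnected_circle _
    have c1 : IsPreconnected A1 := isPreconnected_circle _
    rcases not_and_or.1 hpq with h | h
    · obtain ⟨U, hU, hS, hT, hfU⟩ :=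
        exists_isOpen_image_closure_subset f.continuous c0 c1 h0 h1 hp hq hε h
      exact exists_essential_curve_of_trapping f.continuous hU hfU (.inl ⟨hS, hT⟩)
    · obtain ⟨U, hU, hS, hT, hfU⟩ :=
        exists_isOpen_image_closure_subset f.continuous c1 c0 h1 h0 hq hp hε h
      exact exists_essential_curve_of_trapping f.continuous hU hfU (.inr ⟨hS, hT⟩)
  refine ⟨main, fun hint => ?_⟩
  obtain ⟨γ, hγ, he⟩ := main
  exact (hint γ hγ).ne_empty he
end
end

section
/- Let h : ℝ² → ℝ² be a homeomorphism satisfying ‖h(p) − p‖ ≥ δ for all p ∈ ℝ², for some δ > 0. If for some ε with 0 < ε < δ/4 there exists a periodic ε-chain for h (a finite sequence z₀, z₁, …, zₙ = z₀ with ‖h(zᵢ) − z_{i+1}‖ < ε for 0 ≤ i ≤ n−1), then h possesses a periodic disk chain. -/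
open Set Metric

noncomputable section

/-- An embedded open disk in the plane: an open set homeomorphic to the open unit disk. -/
def IsEmbeddedDisk (U : Set (ℝ × ℝ)) : Prop :=
  IsOpen U ∧ Nonempty (U ≃ₜ Metric.ball (0 : ℝ × ℝ) 1)

/-- A periodic disk chain for `h`: embedded open disks `U 0, …, U n` with `U 0 = U n`,
each disjoint from its image, pairwise equal or disjoint, and consecutive ones joined
by some forward iterate of `h`. -/
def HasPeriodicDiskChain (h : ℝ × ℝ → ℝ × ℝ) : Prop :=
  ∃ (n : ℕ) (U : ℕ → Set (ℝ × ℝ)), 0 < n ∧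
    (∀ i ≤ n, IsEmbeddedDisk (U i)) ∧
    (∀ i ≤ n, h '' U i ∩ U i = ∅) ∧
    (∀ i ≤ n, ∀ j ≤ n, i ≠ j → U i = U j ∨ U i ∩ U j = ∅) ∧
    (∀ i < n, ∃ m : ℕ, 0 < m ∧ (h^[m] '' U i ∩ U (i + 1)).Nonempty) ∧
    U 0 = U n

/-- Two points of a segment are no further apart than its endpoints. -/
theorem dist_le_of_mem_segment {E : Type*} [NormedAddCommGroup E] [NormedSpace ℝ E]
    {a b x y : E} (hx : x ∈ segment ℝ a b) (hy : y ∈ segment ℝ a b) : dist x y ≤ dist a b := by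
  rw [← convexHull_pair] at hx hy
  obtain ⟨u, hu, v, hv, huv⟩ := convexHull_exists_dist_ge2 hx hy
  refine huv.trans ?_
  rcases hu with rfl | rfl <;> rcases hv with rfl | rfl <;> simp [dist_comm]

theorem isCompact_segment_real {E : Type*} [NormedAddCommGroup E] [NormedSpace ℝ E] (a b : E) :
    IsCompact (segment ℝ a b) := by
  rw [← convexHull_pair]
  exact (Set.toFinite ({a, b} : Set E)).isCompact_convexHull (𝕜 := ℝ)

/-- A nonempty bounded convex open subset of the plane is an embedded disk. -/
theorem IsEmbeddedDisk.of_convex {U : Set (ℝ × ℝ)} (ho : IsOpen U) (hc : Convex ℝ U)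
    (hne : U.Nonempty) (hb : Bornology.IsBounded U) : IsEmbeddedDisk U := by
  obtain ⟨e, he, -, -⟩ := exists_homeomorph_image_interior_closure_frontier_eq_unitBall hc
    (by rwa [ho.interior_eq]) hb
  rw [ho.interior_eq] at he
  exact ⟨ho, ⟨(e.image U).trans (Homeomorph.setCongr he)⟩⟩

/-- If two segments meet, exchanging their endpoints does not increase the total length. -/
theorem dist_add_dist_le_of_mem_segments {E : Type*} [NormedAddCommGroup E] [NormedSpace ℝ E]
    {a b c d x : E} (hx : x ∈ segment ℝ a b) (hy : x ∈ segment ℝ c d) :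
    dist a d + dist c b ≤ dist a b + dist c d := by
  have h₁ := dist_add_dist_of_mem_segment hx
  have h₂ := dist_add_dist_of_mem_segment hy
  linarith [dist_triangle a x d, dist_triangle c x b]

/-- The segments along which a shortest periodic `ε`-chain jumps are pairwise disjoint. -/
theorem exists_periodic_chain_disjoint_segments {E : Type*} [NormedAddCommGroup E]
    [NormedSpace ℝ E] {f : E → E} {ε : ℝ} {z : E} (hz : EChain f ε z z) :
    ∃ (n : ℕ) (c : ℕ → E), 0 < n ∧ c n = c 0 ∧ (∀ i < n, dist (f (c i)) (c (i + 1)) < ε) ∧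
      ∀ p q, p < q → q < n → Disjoint (segment ℝ (f (c p)) (c (p + 1)))
        (segment ℝ (f (c q)) (c (q + 1))) := by
  classical
  have hex : ∃ n, ∃ c : ℕ → E, 0 < n ∧ c n = c 0 ∧ ∀ i < n, dist (f (c i)) (c (i + 1)) < ε := by
    obtain ⟨n, c, hn, h0, h1, h⟩ := hz
    exact ⟨n, c, hn, h1.trans h0.symm, h⟩
  obtain ⟨c, hn, hc, hd⟩ := Nat.find_spec hex
  have hmin := fun m (hm : m < Nat.find hex) => Nat.find_min hex hm
  generalize Nat.find hex = n at hn hc hd hmin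
  refine ⟨n, c, hn, hc, hd, fun p q hpq hqn => Set.disjoint_left.2 fun x hx hy => ?_⟩
  have hsum := dist_add_dist_le_of_mem_segments hx hy
  have hp := hd p (by omega)
  have hq := hd q hqn
  by_cases hshort : dist (f (c p)) (c (q + 1)) < ε
  · refine hmin (n - (q - p)) (by omega)
      ⟨fun k => if k ≤ p then c k else c (k + (q - p)), by omega, ?_, fun i hi => ?_⟩
    · simp only [Nat.zero_le, if_true]
      rw [if_neg (by omega), Nat.sub_add_cancel (by omega), hc]
    · rcases lt_trichotomy i p with h | rfl | h
      · simpa [h.le, Nat.succ_le_of_lt h] using hd i (by omega)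
      · have : i + 1 + (q - i) = q + 1 := by omega
        simpa [this] using hshort
      · have h₁ := hd (i + (q - p)) (by omega)
        have h₂ : i + 1 + (q - p) = i + (q - p) + 1 := by omega
        simpa [not_le.2 h, not_le.2 (h.trans (Nat.lt_succ_self i)), h₂] using h₁
  · have hback : dist (f (c q)) (c (p + 1)) < ε := by linarith
    refine hmin (q - p) (by omega)
      ⟨fun k => if k < q - p then c (p + 1 + k) else c (p + 1), by omega, ?_, fun i hi => ?_⟩
    · simp
    · by_cases h : i + 1 < q - p
      · simpa [hi, h, add_assoc] using hd (p + 1 + i) (by omega)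
      · have : p + 1 + i = q := by omega
        simpa [hi, h, this] using hback

/-- Finitely many pairwise disjoint compact sets have pairwise disjoint thickenings of a
common, arbitrarily small radius. -/
theorem exists_disjoint_thickenings {X : Type*} [MetricSpace X] {n : ℕ} {K : ℕ → Set X}
    (hK : ∀ i, IsCompact (K i)) (hd : ∀ p q, p < q → q < n → Disjoint (K p) (K q))
    {ρ : ℝ} (hρ : 0 < ρ) :
    ∃ r, 0 < r ∧ r < ρ ∧
      ∀ p q, p < q → q < n → Disjoint (thickening r (K p)) (thickening r (K q)) := by
  have hev : ∀ᶠ r in nhdsWithin (0 : ℝ) (Ioi 0), ∀ q ∈ Finset.range n, ∀ p ∈ Finset.range q,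
      Disjoint (thickening r (K p)) (thickening r (K q)) := by
    simp only [Filter.eventually_all_finset]
    intro q hq p hp
    obtain ⟨s, hs, hdisj⟩ :=
      (hd p q (Finset.mem_range.1 hp) (Finset.mem_range.1 hq)).exists_thickenings (hK p) (hK q).isClosed
    filter_upwards [Ioo_mem_nhdsGT hs] with r hr
    exact hdisj.mono (thickening_mono hr.2.le _) (thickening_mono hr.2.le _)
  obtain ⟨r, hr, hr₂⟩ := (hev.and (Ioo_mem_nhdsGT hρ)).exists
  exact ⟨r, hr₂.1, hr₂.2, fun p q hpq hqn =>
    hr q (Finset.mem_range.2 hqn) p (Finset.mem_range.2 hpq)⟩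

/-- A plane homeomorphism with uniform displacement `δ > 0` that admits a periodic
`ε`-chain for some `0 < ε < δ/4` possesses a periodic disk chain. -/
theorem periodic_chain_gives_periodic_disk_chain
    (h : (ℝ × ℝ) ≃ₜ (ℝ × ℝ)) (δ : ℝ) (hδ0 : 0 < δ)
    (hδ : ∀ p : ℝ × ℝ, δ ≤ ‖h p - p‖)
    (ε : ℝ) (hε0 : 0 < ε) (hε : ε < δ / 4)
    (z : ℝ × ℝ) (hchain : EChain ⇑h ε z z) :
    HasPeriodicDiskChain ⇑h := by
  obtain ⟨n, c, hn, hc, hd, hdisj⟩ := exists_periodic_chain_disjoint_segments hchain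
  obtain ⟨r, hr, hrδ, hthick⟩ := exists_disjoint_thickenings
    (K := fun i => segment ℝ (h (c i)) (c (i + 1)))
    (fun i => isCompact_segment_real _ _) hdisj (ρ := δ / 4) (by linarith)
  let V : ℕ → Set (ℝ × ℝ) := fun i => thickening r (segment ℝ (h (c i)) (c (i + 1)))
  have hdisk : ∀ i, IsEmbeddedDisk (V i) := fun i =>
    IsEmbeddedDisk.of_convex isOpen_thickening ((convex_segment _ _).thickening r)
      ⟨_, self_subset_thickening hr _ (left_mem_segment ℝ _ _)⟩
      (isCompact_segment_real _ _).isBounded.thickening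
  have hfree : ∀ i < n, h '' V i ∩ V i = ∅ := by
    intro i hi
    refine Set.eq_empty_of_forall_notMem ?_
    rintro _ ⟨⟨x, hx, rfl⟩, hy⟩
    obtain ⟨u, hu, hxu⟩ := mem_thickening_iff.1 hx
    obtain ⟨v, hv, hyv⟩ := mem_thickening_iff.1 hy
    have h₁ := hδ x
    rw [← dist_eq_norm] at h₁
    have h₂ := dist_le_of_mem_segment hv hu
    have h₃ := dist_triangle4 (h x) v u x
    rw [dist_comm u x] at h₃
    linarith [hd i hi]
  have hVV : ∀ p < n, ∀ q < n, V p = V q ∨ V p ∩ V q = ∅ := by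
    intro p hp q hq
    rcases lt_trichotomy p q with hpq | rfl | hpq
    · exact Or.inr (hthick p q hpq hq).inter_eq
    · exact Or.inl rfl
    · exact Or.inr (hthick q p hpq hp).symm.inter_eq
  have hlt : ∀ i ≤ n, (if i = 0 then n - 1 else i - 1) < n := by
    intro i hi
    split_ifs <;> omega
  refine ⟨n, fun i => V (if i = 0 then n - 1 else i - 1), hn, fun i _ => hdisk _,
    fun i hi => hfree _ (hlt i hi), fun i hi j hj _ => hVV _ (hlt i hi) _ (hlt j hj),
    fun i hi => ⟨1, one_pos, h (c i), ⟨c i, ?_, rfl⟩, ?_⟩, ?_⟩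
  · refine self_subset_thickening hr _ ?_
    convert right_mem_segment ℝ _ _ using 1
    split_ifs with h0
    · rw [Nat.sub_add_cancel hn, hc, h0]
    · rw [Nat.sub_add_cancel (Nat.pos_of_ne_zero h0)]
  · exact self_subset_thickening hr _ (left_mem_segment ℝ _ _)
  · simp [hn.ne']
end
end

section
/- Let f : 𝔸 → 𝔸 be a homeomorphism of the annulus whose restrictions to the boundary circles are rigid rotations in opposite directions, i.e., a lift f̃ satisfies f̃(x,1) = (x + r₁, 1) and f̃(x,0) = (x − r₀, 0) for constants r₀, r₁ > 0, and let h : ℝ² → ℝ² be the extension of f̃ with h(x,y) = (x + r₁, y) for y ≥ 1 and h(x,y) = (x − r₀, y) for y ≤ 0. If some chain transitive component of the chain recurrent set ℛ(f) intersects both boundary circles A₀ and A₁, then for every ε > 0 the map h admits a periodic ε-chain. -/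
open Set Metric

noncomputable section

/-- Concatenation of `ε`-chains. -/
theorem EChain.trans_s9 {X : Type*} [MetricSpace X] {f : X → X} {ε : ℝ} {p q r : X}
    (hpq : EChain f ε p q) (hqr : EChain f ε q r) : EChain f ε p r := by
  obtain ⟨n, c, hn, hc0, hcn, hc⟩ := hpq
  obtain ⟨m, d, hm, hd0, hdm, hd⟩ := hqr
  refine ⟨n + m, fun i => if i < n then c i else d (i - n), by omega, ?_, ?_, ?_⟩
  · simp [hn, hc0]
  · simp [hdm]
  · intro i hi
    rcases lt_trichotomy (i + 1) n with h | h | h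
    · have h' : i < n := by omega
      simpa [h, h'] using hc i h'
    · have h' : i < n := by omega
      have := hc i h'
      rw [h, hcn, ← hd0] at this
      simpa [h, h'] using this
    · have h' : ¬ i < n := by omega
      have h'' : ¬ i + 1 < n := by omega
      have := hd (i - n) (by omega)
      rw [show i - n + 1 = i + 1 - n by omega] at this
      simpa [h', h''] using this

/-- A map which commutes with a distance-preserving map `T` carries `ε`-chains to `ε`-chains. -/
theorem EChain.map {X Y : Type*} [MetricSpace X] [MetricSpace Y] {f : X → X} {g : Y → Y}
    {T : X → Y} (hT : Isometry T) (hfg : ∀ x, g (T x) = T (f x)) {ε : ℝ} {p q : X}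
    (hpq : EChain f ε p q) : EChain g ε (T p) (T q) := by
  obtain ⟨n, c, hn, rfl, rfl, hc⟩ := hpq
  exact ⟨n, T ∘ c, hn, rfl, rfl, fun i hi => by simpa [hfg, hT.dist_eq] using hc i hi⟩

/-- Every sufficiently large distance can be divided into equal steps of length close to `r`. -/
theorem exists_step_near {r ε : ℝ} (hr : 0 < r) (hε : 0 < ε) :
    ∃ M : ℝ, ∀ d ≥ M, ∃ n : ℕ, 0 < n ∧ |r - d / n| < ε := by
  refine ⟨r * (r / ε + 1), fun d hd => ⟨⌊d / r⌋₊, ?_⟩⟩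
  have hq : r / ε + 1 ≤ d / r := by rw [le_div_iff₀ hr]; linarith
  have hpos : 0 < r / ε := by positivity
  have hle := Nat.floor_le (show 0 ≤ d / r by linarith)
  have hlt := Nat.lt_floor_add_one (d / r)
  set n := ⌊d / r⌋₊
  have hn : r / ε < n := by linarith
  have hn0 : (0 : ℝ) < n := by linarith
  refine ⟨by exact_mod_cast hn0, ?_⟩
  rw [le_div_iff₀ hr] at hle
  rw [div_lt_iff₀ hr] at hlt
  rw [div_lt_iff₀ hε] at hn
  have h1 : r ≤ d / n := by rw [le_div_iff₀ hn0]; linarith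
  have h2 : d / n < r + ε := by rw [div_lt_iff₀ hn0]; linarith
  rw [abs_lt]
  constructor <;> linarith

/-- On a horizontal line translated by `σ * r`, with `|σ| = 1`, chains reach every point
sufficiently far in the direction of the translation. -/
theorem exists_horizontal_chain {h : ℝ × ℝ → ℝ × ℝ} {σ r y ε : ℝ} (hσ : |σ| = 1)
    (hr : 0 < r) (hε : 0 < ε) (hh : ∀ x, h (x, y) = (x + σ * r, y)) :
    ∃ M : ℝ, ∀ d ≥ M, ∀ x, EChain h ε (x, y) (x + σ * d, y) := by
  obtain ⟨M, hM⟩ := exists_step_near hr hε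
  refine ⟨M, fun d hd x => ?_⟩
  obtain ⟨n, hn, hnd⟩ := hM d hd
  have hn0 : (n : ℝ) ≠ 0 := by exact_mod_cast hn.ne'
  refine ⟨n, fun i => (x + σ * (i * (d / n)), y), hn, by simp, ?_, fun i _ => ?_⟩
  · simp only [mul_div_cancel₀ _ hn0]
  · rw [hh, Prod.dist_eq, dist_self, max_eq_left dist_nonneg, Real.dist_eq]
    have : x + σ * (i * (d / n)) + σ * r - (x + σ * (((i + 1 : ℕ) : ℝ) * (d / n)))
        = σ * (r - d / n) := by
      push_cast; ring
    rwa [this, abs_mul, hσ, one_mul]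

/-- Points of the annulus lift along the covering map without increasing the distance. -/
theorem exists_annCover_dist_eq (P : ℝ × I01) (q : Ann) :
    ∃ Q, annCover Q = q ∧ dist P Q = dist (annCover P) q := by
  obtain ⟨a, y⟩ := q
  obtain ⟨b, rfl⟩ := QuotientAddGroup.mk_surjective a
  refine ⟨(b + round (P.1 - b), y), ?_, ?_⟩
  · refine Prod.ext ?_ rfl
    change ((b + round (P.1 - b) : ℝ) : S1) = (b : S1)
    rw [AddCircle.coe_add, add_eq_left, AddCircle.coe_eq_zero_iff]
    exact ⟨round (P.1 - b), by simp⟩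
  · have : dist P.1 (b + round (P.1 - b)) = dist (P.1 : S1) (b : S1) := by
      rw [dist_eq_norm (P.1 : S1), ← AddCircle.coe_sub, AddCircle.norm_eq, Real.dist_eq]
      simp [sub_sub]
    rw [Prod.dist_eq, Prod.dist_eq, this]
    rfl

/-- `ε`-chains lift along the covering map. -/
theorem IsLift.exists_eChain {f : Ann → Ann} {F : ℝ × I01 → ℝ × I01} (hF : IsLift f F)
    {ε : ℝ} {q : Ann} (P : ℝ × I01) (hpq : EChain f ε (annCover P) q) :
    ∃ Q, annCover Q = q ∧ EChain F ε P Q := by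
  obtain ⟨n, c, hn, hc0, rfl, hc⟩ := hpq
  choose L hL hLd using exists_annCover_dist_eq
  let C : ℕ → ℝ × I01 := fun i => Nat.rec P (fun i z => L (F z) (c (i + 1))) i
  have hC : ∀ i, annCover (C i) = c i := by
    rintro (_ | i)
    · exact hc0.symm
    · exact hL _ _
  refine ⟨C n, hC n, n, C, hn, rfl, rfl, fun i hi => ?_⟩
  change dist (F (C i)) (L (F (C i)) (c (i + 1))) < ε
  rw [hLd, hF.1, hC]
  exact hc i hi

/-- Suppose `f` is a homeomorphism of the annulus which is a rigid rotation on the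
two boundary circles in opposite directions (via a lift `F`) and `h : ℝ² → ℝ²` is the
extension of the lift by the boundary translations. If some chain transitive
component of `ℛ(f)` meets both boundary circles, then `h` admits a periodic
`ε`-chain for every `ε > 0`. -/
theorem extension_has_periodic_chains (f : Ann ≃ₜ Ann)
    (F : (ℝ × I01) ≃ₜ (ℝ × I01)) (hF : IsLift ⇑f ⇑F)
    (r₀ r₁ : ℝ) (hr₀ : 0 < r₀) (hr₁ : 0 < r₁)
    (hb1 : ∀ x : ℝ, F (x, iOne) = (x + r₁, iOne))
    (hb0 : ∀ x : ℝ, F (x, iZero) = (x - r₀, iZero))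
    (h : ℝ × ℝ → ℝ × ℝ)
    (htop : ∀ x y : ℝ, 1 ≤ y → h (x, y) = (x + r₁, y))
    (hbot : ∀ x y : ℝ, y ≤ 0 → h (x, y) = (x - r₀, y))
    (hmid : ∀ p : ℝ × I01, h (p.1, (p.2 : ℝ)) = ((F p).1, ((F p).2 : ℝ)))
    (hcomp : ∃ p ∈ chainRecSet ⇑f,
      (chainComponent ⇑f p ∩ A0).Nonempty ∧ (chainComponent ⇑f p ∩ A1).Nonempty) :
    ∀ ε > 0, ∃ z : ℝ × ℝ, EChain h ε z z := by
  intro ε hε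
  obtain ⟨p, -, ⟨a, ⟨-, -, ha⟩, ha0⟩, ⟨b, ⟨-, -, hb⟩, hb1'⟩⟩ := hcomp
  have hab : EChain f ε a b := (ha ε hε).2.trans_s9 (hb ε hε).1
  have hba : EChain f ε b a := (hb ε hε).2.trans_s9 (ha ε hε).1
  have hcover : ∀ q : Ann, ∃ Q, annCover Q = q := fun q =>
    (exists_annCover_dist_eq (0, iZero) q).imp fun _ => And.left
  obtain ⟨⟨α, s⟩, rfl⟩ := hcover a
  obtain rfl : s = iZero := ha0
  obtain ⟨⟨β, t⟩, rfl, hAB⟩ := hF.exists_eChain _ hab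
  obtain rfl : t = iOne := hb1'
  obtain ⟨⟨α', u⟩, hA', hBA⟩ := hF.exists_eChain _ hba
  obtain rfl : u = iZero := congrArg Prod.snd hA'
  have hι : Isometry fun P : ℝ × I01 => (P.1, (P.2 : ℝ)) :=
    isometry_id.prodMap isometry_subtype_coe
  have hup : EChain h ε (α, 0) (β, 1) := hAB.map hι hmid
  have hdown : EChain h ε (β, 1) (α', 0) := hBA.map hι hmid
  have hstep : ∀ z, h (z + (1, 0)) = h z + (1, 0) := by
    rintro ⟨x, y⟩
    rcases le_total 1 y with hy | hy
    · simp [htop _ y hy, add_right_comm]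
    rcases le_total y 0 with hy' | hy'
    · simp [hbot _ y hy', sub_add_eq_add_sub]
    · have h1 := hmid (x, ⟨y, hy', hy⟩)
      have h2 := hmid (x + 1, ⟨y, hy', hy⟩)
      rw [hF.2 (x, ⟨y, hy', hy⟩)] at h2
      simp only at h1 h2
      simp [h1, h2]
  have hshift : ∀ K : ℕ, EChain h ε (β + K, 1) (α' + K, 0) := by
    intro K
    induction K with
    | zero => simpa using hdown
    | succ K ih =>
      have := ih.map (isometry_add_right ((1, 0) : ℝ × ℝ)) hstep
      simpa [add_assoc] using this
  obtain ⟨M₁, hM₁⟩ := exists_horizontal_chain (h := h) (y := 1) (σ := 1) (by simp) hr₁ hε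
    (fun x => by rw [htop x 1 le_rfl, one_mul])
  obtain ⟨M₀, hM₀⟩ := exists_horizontal_chain (h := h) (y := 0) (σ := -1) (by simp) hr₀ hε
    (fun x => by rw [hbot x 0 le_rfl]; ring_nf)
  obtain ⟨K, hK⟩ := exists_nat_ge (max M₁ (M₀ + α - α'))
  have hright := hM₁ K (le_trans (le_max_left _ _) hK) β
  have hleft := hM₀ (α' + K - α) (by linarith [le_trans (le_max_right _ _) hK]) (α' + K)
  rw [one_mul] at hright
  rw [show α' + K + -1 * (α' + K - α) = α by ring] at hleft
  exact ⟨_, hup.trans_s9 (hright.trans_s9 ((hshift K).trans_s9 hleft))⟩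
end
end

section
/- Let g : S¹ × [a,b] → S¹ × [a,b] be a homeomorphism of an annulus that preserves the second coordinate, i.e., π_y(g(x,y)) = y for all (x,y), where π_y is the projection onto [a,b]. Then every essential simple closed curve γ ⊂ S¹ × [a,b] satisfies g(γ) ∩ γ ≠ ∅. -/
open Set Metric

noncomputable section

/-- A continuous real function avoiding the integers has constant floor. -/
lemma floor_eq_floor_of_forall_ne_intCast {h : ℝ → ℝ} (hc : Continuous h)
    (hne : ∀ (t : ℝ) (n : ℤ), h t ≠ n) (s t : ℝ) : ⌊h s⌋ = ⌊h t⌋ := by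
  have key : ∀ s t, ⌊h s⌋ ≤ ⌊h t⌋ := by
    intro s t
    by_contra! hlt
    obtain ⟨u, hu⟩ := mem_range_of_exists_le_of_exists_ge hc
      ⟨t, (Int.floor_lt.mp hlt).le⟩ ⟨s, Int.floor_le (h s)⟩
    exact hne u _ hu
  exact le_antisymm (key s t) (key t s)

/-- Equality in `S1` means that the difference of representatives is an integer. -/
lemma S1.coe_eq_coe_iff {u v : ℝ} : (u : S1) = v ↔ ∃ n : ℤ, u - v = n := by
  rw [← sub_eq_zero, ← AddCircle.coe_sub, AddCircle.coe_eq_zero_iff]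
  simp [eq_comm]

/-- A self-map of the circle lifts to a self-map of the line commuting with the unit translation
up to the degree. -/
lemma S1.exists_lift (x : C(S1, S1)) : ∃ (q : C(ℝ, ℝ)) (d : ℤ),
    (∀ t : ℝ, (q t : S1) = x t) ∧ ∀ t, q (t + 1) = q t + d := by
  obtain ⟨e, he⟩ := QuotientAddGroup.mk_surjective (x ((0 : ℝ) : S1))
  obtain ⟨q, ⟨-, hq⟩, -⟩ := (AddCircle.isCoveringMap_coe (1 : ℝ)).existsUnique_continuousMap_lifts
    (x.comp ⟨((↑) : ℝ → S1), AddCircle.continuous_mk' 1⟩) 0 e he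
  have hq' : ∀ t : ℝ, (q t : S1) = x t := fun t ↦ congrFun hq t
  have hint : ∀ t, ∃ n : ℤ, q (t + 1) - q t = n := fun t ↦
    S1.coe_eq_coe_iff.mp <| by rw [hq', hq', AddCircle.coe_add_period]
  choose n hn using hint
  have hfloor := floor_eq_floor_of_forall_ne_intCast
    (h := fun t ↦ q (t + 1) - q t + 1 / 2) (by fun_prop) (by
      intro t k hk
      rw [hn t] at hk
      have h2 : (2 * n t + 1 : ℝ) = 2 * k := by linarith
      norm_cast at h2
      omega)
  have hn_eq : ∀ t, n t = n 0 := by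
    intro t
    have := hfloor t 0
    simpa only [hn, Int.floor_intCast_add, add_left_inj] using this
  exact ⟨q, n 0, hq', fun t ↦ by rw [← hn_eq t, ← hn t]; ring⟩

/-- A curve in `S1 × [a, b]` whose angular coordinate lifts to a periodic function is
null-homotopic. -/
lemma nullhomotopic_of_periodic_lift {a b : ℝ} (hab : a ≤ b) (γ : C(S1, S1 × Set.Icc a b))
    (q : C(ℝ, ℝ)) (hq : ∀ t : ℝ, (q t : S1) = (γ t).1) (hper : Function.Periodic q 1) :
    γ.Nullhomotopic := by
  have : ContractibleSpace (Set.Icc a b) :=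
    (convex_Icc a b).contractibleSpace ⟨a, left_mem_Icc.mpr hab⟩
  have hcont : Continuous (hper.lift : S1 → ℝ) := continuous_quot_lift _ q.continuous
  let ψ : C(S1, ℝ × Set.Icc a b) := ⟨fun t ↦ (hper.lift t, (γ t).2), by fun_prop⟩
  let φ : C(ℝ × Set.Icc a b, S1 × Set.Icc a b) :=
    ⟨fun z ↦ ((z.1 : S1), z.2),
      ((AddCircle.continuous_mk' 1).comp continuous_fst).prodMk continuous_snd⟩
  have hγ : γ = (φ.comp (ContinuousMap.id _)).comp ψ := by
    ext1 t
    induction t using QuotientAddGroup.induction_on with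
    | H t => exact Prod.ext (hq t).symm rfl
  rw [hγ]
  exact ((id_nullhomotopic _).comp_right φ).comp_left ψ

lemma IsPreconnected.nonpos_of_sin_nonpos {X : Type*} [TopologicalSpace X] {K : Set X}
    (hK : IsPreconnected K) {θ : X → ℝ} (hθ : Continuous θ) (hsin : ∀ z ∈ K, Real.sin (θ z) ≤ 0)
    {A : X} (hA : A ∈ K) (hθA : θ A = 0) {z : X} (hz : z ∈ K) : θ z ≤ 0 := by
  by_contra! hpos
  have hpi := Real.pi_pos
  obtain ⟨w, hw, hwθ⟩ := hK.intermediate_value hA hz hθ.continuousOn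
    (show min (θ z) (Real.pi / 2) ∈ Set.Icc (θ A) (θ z) from
      ⟨hθA ▸ le_min hpos.le (by positivity), min_le_left _ _⟩)
  have := hsin w hw
  rw [hwθ] at this
  exact this.not_gt <| Real.sin_pos_of_pos_of_lt_pi (lt_min hpos (by positivity))
    ((min_le_right _ _).trans_lt (by linarith))

/-- If `f` and `h` have no common zero on a simply connected space, and two points can be joined
both by a connected set where `f ≤ 0` and by a connected set where `f ≥ 0`, then `h` has the same
sign at these points. -/
lemma pos_of_pos_of_isPreconnected {X : Type*} [TopologicalSpace X] [SimplyConnectedSpace X]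
    [LocallyPathConnectedSpace X] {f h : X → ℝ} (hf : Continuous f) (hh : Continuous h)
    (hne : ∀ z, f z = 0 → h z ≠ 0) {K L : Set X} (hK : IsPreconnected K) (hL : IsPreconnected L)
    (hfK : ∀ z ∈ K, f z ≤ 0) (hfL : ∀ z ∈ L, 0 ≤ f z) {A B : X} (hAK : A ∈ K) (hAL : A ∈ L)
    (hBK : B ∈ K) (hBL : B ∈ L) (hA : 0 < h A) : 0 < h B := by
  have hfA : f A = 0 := le_antisymm (hfK A hAK) (hfL A hAL)
  let φ : C(X, ℂ) := ⟨fun z ↦ h z + f z * Complex.I, by fun_prop⟩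
  have hφre : ∀ z, (φ z).re = h z := fun z ↦ by simp [φ]
  have hφim : ∀ z, (φ z).im = f z := fun z ↦ by simp [φ]
  obtain ⟨F, ⟨hFA, hF⟩, -⟩ := Complex.isCoveringMapOn_exp.existsUnique_continuousMap_lifts φ
    (a₀ := A) (e₀ := (Real.log (h A) : ℂ))
    (by rw [← Complex.ofReal_exp, Real.exp_log hA]; simp [φ, hfA])
    (fun z hz ↦ hne z (by rw [← hφim, hz]; rfl) (by rw [← hφre, hz]; rfl))
  have hexp : ∀ z, Complex.exp (F z) = φ z := fun z ↦ congrFun hF z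
  have him : ∀ z, f z = Real.exp (F z).re * Real.sin (F z).im := fun z ↦ by
    rw [← hφim, ← hexp, Complex.exp_im]
  have hre : ∀ z, h z = Real.exp (F z).re * Real.cos (F z).im := fun z ↦ by
    rw [← hφre, ← hexp, Complex.exp_re]
  have hθ : Continuous fun z ↦ (F z).im := Complex.continuous_im.comp F.continuous
  have hθA : (F A).im = 0 := by rw [hFA, Complex.ofReal_im]
  have hle : (F B).im ≤ 0 := hK.nonpos_of_sin_nonpos hθ (fun z hz ↦ by
    have := hfK z hz
    rw [him] at this
    exact nonpos_of_mul_nonpos_right this (Real.exp_pos _)) hAK hθA hBK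
  have hge : -(F B).im ≤ 0 := hL.nonpos_of_sin_nonpos (θ := fun z ↦ -(F z).im) hθ.neg (fun z hz ↦ by
    have := hfL z hz
    rw [him] at this
    rw [Real.sin_neg]
    exact neg_nonpos.mpr (nonneg_of_mul_nonneg_right this (Real.exp_pos _))) hAL
      (by rw [hθA, neg_zero]) hBL
  rw [hre, le_antisymm hle (neg_nonpos.mp hge), Real.cos_zero, mul_one]
  exact Real.exp_pos _

lemma isPreconnected_cross {X Y : Type*} [TopologicalSpace X] [TopologicalSpace Y]
    [PreconnectedSpace X] [PreconnectedSpace Y] (x : X) (y : Y) :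
    IsPreconnected ({z | z.1 = x ∨ z.2 = y} : Set (X × Y)) := by
  have h : ({z | z.1 = x ∨ z.2 = y} : Set (X × Y)) = {x} ×ˢ univ ∪ univ ×ˢ {y} := by
    ext z; simp
  rw [h]
  exact (isPreconnected_singleton.prod isPreconnected_univ).union (x, y) (by simp) (by simp)
    (isPreconnected_univ.prod isPreconnected_singleton)

/-- Given a height `y` attaining its minimum at `m` and `m'` and its maximum at `M`, a function
`h` of pairs of parameters that is nonzero at pairs of equal height has the same sign at
`(m, m')` and `(M, M)`. -/
lemma pos_of_pos_of_isMin_of_isMax {y : ℝ → ℝ} (hy : Continuous y) {h : ℝ × ℝ → ℝ}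
    (hh : Continuous h) (hne : ∀ z : ℝ × ℝ, y z.1 = y z.2 → h z ≠ 0) {m m' M : ℝ}
    (hm : ∀ t, y m ≤ y t) (hm' : ∀ t, y m' ≤ y t) (hM : ∀ t, y t ≤ y M)
    (hpos : 0 < h (m, m')) : 0 < h (M, M) := by
  refine pos_of_pos_of_isPreconnected (f := fun z ↦ y z.1 - y z.2) (by fun_prop) hh
    (fun z hz ↦ hne z (sub_eq_zero.mp hz)) (isPreconnected_cross m M) (isPreconnected_cross M m')
    ?_ ?_ (A := (m, m')) (by simp) (by simp) (by simp) (by simp) hpos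
  · rintro ⟨s, t⟩ (rfl | rfl)
    exacts [sub_nonpos.mpr (hm t), sub_nonpos.mpr (hM s)]
  · rintro ⟨s, t⟩ (rfl | rfl)
    exacts [sub_nonneg.mpr (hM t), sub_nonneg.mpr (hm' s)]

/-- A homeomorphism of the annulus `S¹ × [a,b]` preserving the second coordinate
meets every essential simple closed curve (continuous, injective, not
null-homotopic): `g(γ) ∩ γ ≠ ∅`. -/
theorem intersection_property_of_second_coordinate_preserving
    (a b : ℝ) (hab : a < b)
    (g : (S1 × Set.Icc a b) ≃ₜ (S1 × Set.Icc a b))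
    (hg : ∀ p : S1 × Set.Icc a b, (g p).2 = p.2)
    (γ : C(S1, S1 × Set.Icc a b))
    (hinj : Function.Injective γ) (hess : ¬ γ.Nullhomotopic) :
    (⇑g '' Set.range γ ∩ Set.range γ).Nonempty := by
  by_contra hempty
  have hdisj : ∀ s t : S1, g (γ t) ≠ γ s := fun s t hst ↦
    hempty ⟨γ s, ⟨γ t, mem_range_self t, hst⟩, mem_range_self s⟩
  obtain ⟨q, d, hq, hqd⟩ := S1.exists_lift ⟨fun t ↦ (γ t).1, by fun_prop⟩
  obtain ⟨p, e, hp, hpe⟩ := S1.exists_lift ⟨fun t ↦ (g (γ t)).1, by fun_prop⟩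
  simp only [ContinuousMap.coe_mk] at hq hp
  have hd : d ≠ 0 := by
    rintro rfl
    exact hess (nullhomotopic_of_periodic_lift hab.le γ q hq fun t ↦ by simpa using hqd t)
  let Y : S1 → ℝ := fun t ↦ (γ t).2
  have hY : Continuous Y := by fun_prop
  let y : ℝ → ℝ := fun t ↦ Y t
  have hy : Continuous y := hY.comp (AddCircle.continuous_mk' 1)
  have hne : ∀ s t : ℝ, y s = y t → ∀ n : ℤ, p t - q s ≠ n := by
    intro s t hst n hn
    refine hdisj s t (Prod.ext ?_ ((hg _).trans (Subtype.ext hst.symm)))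
    rw [← hp, ← hq]
    exact S1.coe_eq_coe_iff.mpr ⟨n, hn⟩
  have hfloor := floor_eq_floor_of_forall_ne_intCast (h := fun t ↦ p t - q t) (by fun_prop)
    (fun t ↦ hne t t rfl)
  have hed : e = d := by
    have h1 := hfloor (0 + 1) 0
    simp only [hpe, hqd] at h1
    rw [show p 0 + (e : ℝ) - (q 0 + d) = p 0 - q 0 + ((e - d : ℤ) : ℝ) by push_cast; ring,
      Int.floor_add_intCast] at h1
    omega
  obtain ⟨m, hm⟩ : ∃ m : ℝ, ∀ t, y m ≤ y t := by
    obtain ⟨m, -, hm⟩ := isCompact_univ.exists_isMinOn univ_nonempty hY.continuousOn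
    obtain ⟨m, rfl⟩ := QuotientAddGroup.mk_surjective m
    exact ⟨m, fun t ↦ hm (mem_univ _)⟩
  obtain ⟨M, hM⟩ : ∃ M : ℝ, ∀ t, y t ≤ y M := by
    obtain ⟨M, -, hM⟩ := isCompact_univ.exists_isMaxOn univ_nonempty hY.continuousOn
    obtain ⟨M, rfl⟩ := QuotientAddGroup.mk_surjective M
    exact ⟨M, fun t ↦ hM (mem_univ _)⟩
  have hm' : ∀ t, y (m + 1) ≤ y t := by
    have : y (m + 1) = y m := congrArg Y (AddCircle.coe_add_period 1 m)
    exact this ▸ hm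
  have hmM := hfloor m M
  have hlm := Int.floor_le (p m - q m)
  have hlM := Int.floor_le (p M - q M)
  have hum := Int.lt_floor_add_one (p m - q m)
  have huM := Int.lt_floor_add_one (p M - q M)
  have hpm := hpe m
  rw [hed] at hpm
  simp only [hmM] at hlm hum
  have hlm' := lt_of_le_of_ne hlm (hne m m rfl _).symm
  rcases hd.lt_or_gt with hneg | hpos
  · have hd1 : (d : ℝ) ≤ -1 := by exact_mod_cast Int.le_sub_one_of_lt hneg
    have := pos_of_pos_of_isMin_of_isMax hy
      (h := fun z ↦ ⌊p M - q M⌋ - (p z.2 - q z.1)) (by fun_prop)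
      (fun z hz h0 ↦ hne _ _ hz _ (sub_eq_zero.mp h0).symm) hm hm' hM
      (by dsimp only; linarith)
    dsimp only at this
    linarith
  · have hd1 : (1 : ℝ) ≤ d := by exact_mod_cast hpos
    have := pos_of_pos_of_isMin_of_isMax hy
      (h := fun z ↦ p z.2 - q z.1 - (⌊p M - q M⌋ + 1 : ℤ)) (by fun_prop)
      (fun z hz h0 ↦ hne _ _ hz _ (sub_eq_zero.mp h0)) hm hm' hM
      (by dsimp only; push_cast; linarith)
    dsimp only at this
    push_cast at this
    linarith
end
end

section
/- Let f : 𝔸 → 𝔸 be a homeomorphism of the annulus satisfying the twist condition, and suppose f is reversible with respect to the involution R(x,y) = (−x, y), i.e., f⁻¹ = R ∘ f ∘ R. Then f has at least one fixed point. -/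
open Set Metric

noncomputable section

/-- The standard involution `R(x,y) = (−x, y)` of the annulus. -/
def annR : Ann → Ann := fun p => (-p.1, p.2)

/-- The lift `(x,y) ↦ (-x,y)` of the involution `annR` to the strip. -/
def stripR : ℝ × I01 → ℝ × I01 := fun p => (-p.1, p.2)

lemma continuous_stripR : Continuous stripR := by
  unfold stripR
  fun_prop

@[simp]
lemma stripR_stripR (p : ℝ × I01) : stripR (stripR p) = p := by
  simp [stripR]

lemma annCover_stripR (p : ℝ × I01) : annCover (stripR p) = annR (annCover p) := by
  simp [annCover, stripR, annR]

/-- A nowhere vanishing continuous complex function on the strip has a continuous logarithm. -/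
lemma exists_continuous_log {g : ℝ × I01 → ℂ} (hg : Continuous g) (h0 : ∀ p, g p ≠ 0) :
    ∃ L : ℝ × I01 → ℂ, Continuous L ∧ ∀ p, Complex.exp (L p) = g p := by
  let e : C(ℝ × ℝ, ℂ) :=
    ⟨fun q => g (q.1, projIcc 0 1 zero_le_one q.2),
      hg.comp (continuous_fst.prodMk (continuous_projIcc.comp continuous_snd))⟩
  obtain ⟨L, ⟨-, hL⟩, -⟩ := Complex.isCoveringMapOn_exp.existsUnique_continuousMap_lifts e
    (a₀ := (0, 0)) (Complex.exp_log (h0 _)) (fun q => h0 _)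
  refine ⟨fun p => L (p.1, p.2), by fun_prop, fun p => ?_⟩
  simpa [e] using congr_fun hL (p.1, (p.2 : ℝ))

/-- A continuous function on a preconnected space with integer values is constant. -/
lemma eq_of_forall_exists_int {X : Type*} [TopologicalSpace X] [PreconnectedSpace X] {c : X → ℝ}
    (hc : Continuous c) (hint : ∀ p, ∃ n : ℤ, c p = n) (p q : X) : c p = c q := by
  refine isPreconnected_univ.constant_of_mapsTo (T := Set.range ((↑) : ℤ → ℝ))
    ?_ hc.continuousOn (fun x _ => ?_) (mem_univ p) (mem_univ q)
  · exact Int.isClosedEmbedding_coe_real.isEmbedding.isDiscrete_range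
  · obtain ⟨n, hn⟩ := hint x
    exact ⟨n, hn.symm⟩

/-- If a nowhere vanishing function `g` on the strip satisfies `g ∘ σ = conj ∘ g`, and `g` has
positive real part at one fixed point of `σ`, then it does so at every fixed point of `σ`. -/
lemma re_pos_of_conj_equivariant {g : ℝ × I01 → ℂ} (hg : Continuous g)
    (h0 : ∀ p, g p ≠ 0) {σ : ℝ × I01 → ℝ × I01} (hσ : Continuous σ)
    (hconj : ∀ p, g (σ p) = starRingEnd ℂ (g p)) {p q : ℝ × I01} (hp : σ p = p) (hq : σ q = q)
    (hgp : 0 < (g p).re) : 0 < (g q).re := by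
  obtain ⟨L, hLc, hL⟩ := exists_continuous_log hg h0
  have hconst : ((L (σ p)).im + (L p).im) / (2 * Real.pi)
      = ((L (σ q)).im + (L q).im) / (2 * Real.pi) := by
    refine eq_of_forall_exists_int
      (c := fun p => ((L (σ p)).im + (L p).im) / (2 * Real.pi)) (by fun_prop) (fun x => ?_) p q
    have h : Complex.exp (L (σ x)) = Complex.exp (starRingEnd ℂ (L x)) := by
      rw [Complex.exp_conj, hL, hL, hconj]
    obtain ⟨n, hn⟩ := Complex.exp_eq_exp_iff_exists_int.1 h
    refine ⟨n, ?_⟩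
    have him := congrArg Complex.im hn
    simp at him
    rw [him]
    field_simp
    ring
  rw [hp, hq, div_left_inj' (by positivity)] at hconst
  have him : (L p).im = (L q).im := by linarith
  rw [← hL, Complex.exp_re] at hgp ⊢
  rw [← him]
  exact mul_pos (Real.exp_pos _) (pos_of_mul_pos_right hgp (Real.exp_pos _).le)

/-- A continuous `1`-periodic displacement `r` satisfies `x + r x = -x` for some `x`. -/
lemma exists_add_periodic_eq_neg {r : ℝ → ℝ} (hr : Continuous r) (hper : Function.Periodic r 1) :
    ∃ x, x + r x = -x := by
  obtain ⟨n, hn⟩ := exists_nat_gt |r 0|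
  have hpos : r n = r 0 := by simpa using hper.nat_mul n 0
  have hneg : r (-n) = r 0 := by simpa using hper.sub_nat_mul_eq (x := 0) n
  have hn' := abs_lt.1 hn
  obtain ⟨x, hx⟩ := mem_range_of_exists_le_of_exists_ge (f := fun x => 2 * x + r x) (c := 0)
    (by fun_prop) ⟨-n, by simp only [hneg]; linarith⟩ ⟨n, by simp only [hpos]; linarith⟩
  exact ⟨x, by linarith⟩

/-- If a lift `F` translates a boundary line by `r`, then `stripR ∘ F` fixes a point of it. -/
lemma exists_stripR_lift_eq {f : Ann → Ann} {F : ℝ × I01 → ℝ × I01} (hF : Continuous F)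
    (hlift : IsLift f F) {y : I01} {r : ℝ → ℝ} (hr : ∀ x, F (x, y) = (x + r x, y)) :
    ∃ x, stripR (F (x, y)) = (x, y) := by
  have hreq : r = fun x => (F (x, y)).1 - x := by
    funext x
    simp [hr]
  obtain ⟨x, hx⟩ := exists_add_periodic_eq_neg (r := r) (by rw [hreq]; fun_prop) fun x => by
    have := congrArg Prod.fst (hlift.2 (x, y))
    simp only [hr] at this
    linarith
  exact ⟨x, by simp [hr, hx, stripR]⟩

/-- A lift of a reversible map is reversible, if `stripR ∘ F` has a fixed point. -/
lemma lift_stripR_lift {f : Ann ≃ₜ Ann} (hrev : ∀ p : Ann, f.symm p = annR (f (annR p)))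
    {F : ℝ × I01 → ℝ × I01} (hF : Continuous F) (hlift : IsLift f F) {p₀ : ℝ × I01}
    (hp₀ : stripR (F p₀) = p₀) (p : ℝ × I01) : F (stripR (F p)) = stripR p := by
  have hcov (p : ℝ × I01) : annCover (F (stripR (F p))) = annCover (stripR p) := by
    rw [hlift.1, annCover_stripR, hlift.1, ← f.apply_symm_apply (annCover (stripR p)), hrev,
      ← annCover_stripR, stripR_stripR]
  have hint (p : ℝ × I01) : ∃ n : ℤ, (F (stripR (F p))).1 - (stripR p).1 = n := by
    have h : (((F (stripR (F p))).1 : ℝ) : S1) = ((stripR p).1 : ℝ) := congrArg Prod.fst (hcov p)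
    rw [← sub_eq_zero, ← AddCircle.coe_sub, AddCircle.coe_eq_zero_iff] at h
    obtain ⟨n, hn⟩ := h
    exact ⟨n, by simpa using hn.symm⟩
  have hcont := continuous_stripR
  have hconst := eq_of_forall_exists_int (by fun_prop) hint p p₀
  have hFp₀ : F p₀ = stripR p₀ := by rw [← stripR_stripR (F p₀), hp₀]
  rw [hp₀, hFp₀, sub_self, sub_eq_zero] at hconst
  exact Prod.ext hconst (congrArg (fun a : Ann => a.2) (hcov p))

/-- A reversible twist homeomorphism of the annulus (reversible with respect to the
involution `R(x,y) = (−x,y)`, i.e. `f⁻¹ = R ∘ f ∘ R`) has at least one fixed point. -/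
theorem reversible_twist_map_has_fixed_point (f : Ann ≃ₜ Ann)
    (htwist : TwistCondition ⇑f)
    (hrev : ∀ p : Ann, f.symm p = annR (f (annR p))) :
    ∃ p : Ann, f p = p := by
  obtain ⟨F, hlift, r₀, r₁, hr₀, hr₁, hF₁, hF₀⟩ := htwist
  by_contra! hfix
  have hFc : Continuous F := F.continuous
  obtain ⟨x₁, hx₁⟩ := exists_stripR_lift_eq hFc hlift hF₁
  obtain ⟨x₀, hx₀⟩ := exists_stripR_lift_eq (r := fun x => -r₀ x) hFc hlift
    fun x => by rw [hF₀, sub_eq_add_neg]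
  have hinv := lift_stripR_lift hrev hFc hlift hx₁
  let V : ℝ × I01 → ℂ := fun p => ((F p).1 - p.1 : ℝ) + ((F p).2 - p.2 : ℝ) * Complex.I
  have hre (p : ℝ × I01) : (V p).re = (F p).1 - p.1 := by simp [V]
  have him (p : ℝ × I01) : (V p).im = (F p).2 - p.2 := by simp [V]
  have hV : Continuous V := by fun_prop
  have hV0 (p : ℝ × I01) : V p ≠ 0 := fun h => by
    have h1 := congrArg Complex.re h
    have h2 := congrArg Complex.im h
    rw [hre, Complex.zero_re, sub_eq_zero] at h1
    rw [him, Complex.zero_im, sub_eq_zero] at h2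
    refine hfix (annCover p) ?_
    rw [← hlift.1, Prod.ext h1 (Subtype.ext h2)]
  have hconj (p : ℝ × I01) : V ((stripR ∘ F) p) = starRingEnd ℂ (V p) := by
    apply Complex.ext
    · rw [Complex.conj_re, hre, hre, Function.comp_apply, hinv]
      simp only [stripR]
      ring
    · rw [Complex.conj_im, him, him, Function.comp_apply, hinv]
      simp only [stripR]
      ring
  have hpos : 0 < (V (x₁, iOne)).re := by
    rw [hre, hF₁]
    linarith [hr₁ x₁]
  have hneg := re_pos_of_conj_equivariant hV hV0 (continuous_stripR.comp hFc) hconj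
    hx₁ hx₀ hpos
  rw [hre, hF₀] at hneg
  linarith [hr₀ x₀]
end
end
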